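/- Let G be a dihedral group of order 2n, where n ≥ 3 is odd. Then ω(G) = D(G) = 2n. -/

import Mathlib

namespace ProductOne

open scoped Classical

variable {G : Type*} [Group G]

/-- `S` is a product-one sequence over `G`: its terms can be ordered with product `1`. -/
def IsProductOne (S : Multiset G) : Prop :=
  ∃ l : List G, (l : Multiset G) = S ∧ l.prod = 1

/-- `S` is an atom (a minimal product-one sequence): it is a nontrivial product-one
sequence that is not the concatenation of two nontrivial product-one sequences. -/
def IsAtomSeq (S : Multiset G) : Prop :=
  S ≠ 0 ∧ IsProductOne S ∧
    ∀ A B : Multiset G, S = A + B → IsProductOne A → IsProductOne B → A = 0 ∨ B = 0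

/-- `S` is a sequence over the subset `G₀ ⊆ G`. -/
def SeqOn (G₀ : Set G) (S : Multiset G) : Prop := ∀ g ∈ S, g ∈ G₀

/-- `S` is an atom of the monoid `B(G₀)` of product-one sequences over `G₀`. -/
def IsAtomSeqOn (G₀ : Set G) (S : Multiset G) : Prop := SeqOn G₀ S ∧ IsAtomSeq S

/-- The set of lengths `L(A)` of factorizations of `A` into atoms over `G₀`. -/
def lengthsOn (G₀ : Set G) (A : Multiset G) : Set ℕ :=
  {k | ∃ f : Multiset (Multiset G), Multiset.card f = k ∧
        (∀ U ∈ f, IsAtomSeqOn G₀ U) ∧ f.sum = A}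

/-- The set of lengths `L(A)` over the whole group. -/
def lengths (A : Multiset G) : Set ℕ := lengthsOn Set.univ A

/-- The set of distances of a set `L ⊆ ℕ`. -/
def distancesOf (L : Set ℕ) : Set ℕ :=
  {d | 0 < d ∧ ∃ a, a ∈ L ∧ a + d ∈ L ∧ ∀ b ∈ L, ¬(a < b ∧ b < a + d)}

/-- The set of distances `Δ(G₀)` of the monoid `B(G₀)`. -/
def DeltaOn (G₀ : Set G) : Set ℕ :=
  {d | ∃ A : Multiset G, SeqOn G₀ A ∧ IsProductOne A ∧ d ∈ distancesOf (lengthsOn G₀ A)}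

/-- The set of distances `Δ(G)` of `B(G)`. -/
def Delta (G : Type*) [Group G] : Set ℕ := DeltaOn (Set.univ : Set G)

/-- The large Davenport constant of `G₀`: maximal length of an atom of `B(G₀)`. -/
noncomputable def DavenportOn (G₀ : Set G) : ℕ :=
  sSup {k | ∃ S : Multiset G, IsAtomSeqOn G₀ S ∧ Multiset.card S = k}

/-- The large Davenport constant `D(G)`. -/
noncomputable def Davenport (G : Type*) [Group G] : ℕ :=
  DavenportOn (Set.univ : Set G)

/-- The small Davenport constant `d(G₀)`: maximal length of a product-one free
sequence over `G₀`. -/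
noncomputable def smallDavenportOn (G₀ : Set G) : ℕ :=
  sSup {k | ∃ S : Multiset G, SeqOn G₀ S ∧ Multiset.card S = k ∧
        ∀ T : Multiset G, T ≤ S → T ≠ 0 → ¬IsProductOne T}

/-- `Δ*(G) = {min Δ(G₀) : G₀ ⊆ G with Δ(G₀) ≠ ∅}`. -/
def DeltaStar (G : Type*) [Group G] : Set ℕ :=
  {d | ∃ G₀ : Set G, (DeltaOn G₀).Nonempty ∧ d = sInf (DeltaOn G₀)}

/-- The elasticity `ρ(L) = max L / min L` of a set of lengths (with the set of
positive elements used, and `ρ = 1` if there are none). -/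
noncomputable def elasticity (L : Set ℕ) : ℚ :=
  if (L ∩ {k | 0 < k}).Nonempty then
    ((sSup (L ∩ {k | 0 < k}) : ℕ) : ℚ) / ((sInf (L ∩ {k | 0 < k}) : ℕ) : ℚ)
  else 1

/-- The elasticity `ρ(G₀)` of the monoid `B(G₀)`. -/
noncomputable def rhoOn (G₀ : Set G) : ℝ :=
  sSup {x : ℝ | ∃ A : Multiset G, SeqOn G₀ A ∧ IsProductOne A ∧
    x = (elasticity (lengthsOn G₀ A) : ℝ)}

/-- `Δ*_ρ(G) = {min Δ(G₀) : G₀ ⊆ G with ρ(G₀) = D(G)/2}`. -/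
noncomputable def DeltaRhoStar (G : Type*) [Group G] : Set ℕ :=
  {d | ∃ G₀ : Set G, rhoOn G₀ = (Davenport G : ℝ) / 2 ∧ d = sInf (DeltaOn G₀)}

/-- Divisibility in the monoid `B(G)`. -/
def BDvd (A S : Multiset G) : Prop :=
  ∃ C : Multiset G, IsProductOne C ∧ S = A + C

/-- The `ω`-invariant `ω(B(G), A)`. -/
noncomputable def omegaAt (A : Multiset G) : ℕ∞ :=
  sInf {N : ℕ∞ | ∀ f : Multiset (Multiset G),
    (∀ B ∈ f, IsProductOne B) → BDvd A f.sum →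
    ∃ t ≤ f, (Multiset.card t : ℕ∞) ≤ N ∧ BDvd A t.sum}

/-- `ω(G) = sup {ω(B(G), U) : U an atom of B(G)}`. -/
noncomputable def omegaInv (G : Type*) [Group G] : ℕ∞ :=
  ⨆ U ∈ {U : Multiset G | IsAtomSeq U}, omegaAt U

/-- `z` is a factorization of `A` into atoms. -/
def IsFactorization (A : Multiset G) (z : Multiset (Multiset G)) : Prop :=
  (∀ U ∈ z, IsAtomSeq U) ∧ z.sum = A

/-- The distance between two factorizations. -/
noncomputable def factDist (z z' : Multiset (Multiset G)) : ℕ :=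
  letI := Classical.decEq (Multiset G)
  max (Multiset.card (z - z')) (Multiset.card (z' - z))

/-- The catenary degree `c(A)`. -/
noncomputable def catenaryAt (A : Multiset G) : ℕ∞ :=
  sInf {N : ℕ∞ | ∀ z z' : Multiset (Multiset G),
    IsFactorization A z → IsFactorization A z' →
    Relation.ReflTransGen
      (fun x y => IsFactorization A y ∧ (factDist x y : ℕ∞) ≤ N) z z'}

/-- The set of positive catenary degrees `Ca(G)`. -/
noncomputable def CatenarySet (G : Type*) [Group G] : Set ℕ∞ :=
  {c | ∃ A : Multiset G, IsProductOne A ∧ catenaryAt A = c ∧ 0 < c}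

/-- The catenary degree `c(G)` of `B(G)`. -/
noncomputable def catenaryDegree (G : Type*) [Group G] : ℕ∞ :=
  ⨆ A ∈ {A : Multiset G | IsProductOne A}, catenaryAt A

/-- The cross number `k(S)` of a sequence. -/
noncomputable def crossNumber (S : Multiset G) : ℚ :=
  (S.map fun g => (1 : ℚ) / (orderOf g : ℚ)).sum

/-- The system of sets of lengths `L(G)`. -/
def LSystem (G : Type*) [Group G] : Set (Set ℕ) :=
  {L | ∃ A : Multiset G, IsProductOne A ∧ L = lengths A}

/-- The set of products `π(S)` of all orderings of the terms of `S`. -/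
def piSet (S : Multiset G) : Set G :=
  {g | ∃ l : List G, (l : Multiset G) = S ∧ l.prod = g}

/-- The sumset `{x₁, -x₁} + ⋯ + {x_s, -x_s}` for a sequence `a = x₁ ⋯ x_s`. -/
def signedSums {α : Type*} [AddCommGroup α] (a : Multiset α) : Set α :=
  {z | ∃ t ≤ a, z = t.sum + t.sum - a.sum}

/-- `Σ_k(T)`: the set of sums of `k`-term subsequences of `T`. -/
def subseqSums {α : Type*} [AddCommMonoid α] (k : ℕ) (T : Multiset α) : Set α :=
  {z | ∃ t ≤ T, Multiset.card t = k ∧ t.sum = z}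

/-- The subsequence `S_X` of all terms of `S` lying in `X`. -/
noncomputable def restrictTo (X : Set G) (S : Multiset G) : Multiset G :=
  letI := Classical.decPred fun g => g ∈ X
  S.filter fun g => g ∈ X

/-- The maximum multiplicity `h(S)` of a term of `S`. -/
noncomputable def maxMultiplicity {α : Type*} (S : Multiset α) : ℕ :=
  letI := Classical.decEq α
  S.toFinset.sup S.count

end ProductOne

namespace ProductOne

/-! ### Signed sums over a dihedral group -/

/-- `1` on reflections and `0` on rotations. -/
def reflInd {n : ℕ} : DihedralGroup n → ℤ
  | .r _ => 0
  | .sr _ => 1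

/-- The index `i` of a rotation `r i` or a reflection `sr i`. -/
def dihIdx {n : ℕ} : DihedralGroup n → ZMod n
  | .r i => i
  | .sr i => i

section Characterization

variable {n : ℕ} {ι : Type*}

@[simp] theorem reflInd_one : reflInd (1 : DihedralGroup n) = 0 := rfl

@[simp] theorem dihIdx_one : dihIdx (1 : DihedralGroup n) = 0 := rfl

theorem exists_sign_mul (g h : DihedralGroup n) : ∃ e : ℤ, (e = 1 ∨ e = -1) ∧
    reflInd (g * h) = e * reflInd g + reflInd h ∧
    dihIdx (g * h) = (e : ZMod n) * dihIdx g + dihIdx h := by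
  rcases g with i | i <;> rcases h with j | j
  · exact ⟨1, by simp, by simp [reflInd], by simp [dihIdx]⟩
  · exact ⟨-1, by simp, by simp [reflInd], by simp [dihIdx]; ring⟩
  · exact ⟨1, by simp, by simp [reflInd], by simp [dihIdx]⟩
  · exact ⟨-1, by simp, by simp [reflInd], by simp [dihIdx]; ring⟩

theorem exists_sign_list [DecidableEq ι] (x : ι → DihedralGroup n) (l : List ι) (hl : l.Nodup) :
    ∃ ε : ι → ℤ, (∀ i, ε i = 1 ∨ ε i = -1) ∧
      (l.map fun i => ε i * reflInd (x i)).sum = reflInd (l.map x).prod ∧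
      (l.map fun i => (ε i : ZMod n) * dihIdx (x i)).sum = dihIdx (l.map x).prod := by
  induction l with
  | nil => exact ⟨fun _ => 1, by simp, by simp, by simp⟩
  | cons a l ih =>
    obtain ⟨ha, hl⟩ := List.nodup_cons.1 hl
    obtain ⟨ε, hε, h1, h2⟩ := ih hl
    obtain ⟨e, he, h3, h4⟩ := exists_sign_mul (x a) (l.map x).prod
    have hne : ∀ i ∈ l, Function.update ε a e i = ε i := fun i hi =>
      Function.update_of_ne (by rintro rfl; exact ha hi) _ _
    refine ⟨Function.update ε a e, fun i => ?_, ?_, ?_⟩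
    · by_cases h : i = a
      · subst h; simpa using he
      · simpa [Function.update_of_ne h] using hε i
    · simp only [List.map_cons, List.sum_cons, List.prod_cons, Function.update_self, h3]
      rw [← h1]
      congr 2
      exact List.map_congr_left fun i hi => by rw [hne i hi]
    · simp only [List.map_cons, List.sum_cons, List.prod_cons, Function.update_self, h4]
      rw [← h2]
      congr 2
      exact List.map_congr_left fun i hi => by rw [hne i hi]

theorem exists_list_map_eq {α β : Type*} (f : α → β) (s : Multiset α) (l : List β)
    (h : (l : Multiset β) = s.map f) : ∃ l' : List α, (l' : Multiset α) = s ∧ l'.map f = l := by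
  classical
  induction l generalizing s with
  | nil => exact ⟨[], by simpa [eq_comm] using h, rfl⟩
  | cons b l ih =>
    have hb : b ∈ s.map f := by rw [← h]; simp
    obtain ⟨a, ha, rfl⟩ := Multiset.mem_map.1 hb
    obtain ⟨t, rfl⟩ := Multiset.exists_cons_of_mem ha
    rw [← Multiset.cons_coe, Multiset.map_cons, Multiset.cons_inj_right] at h
    obtain ⟨l', rfl, rfl⟩ := ih t h
    exact ⟨a :: l', rfl, rfl⟩

/-- A product-one sequence over a dihedral group has a zero signed sum. -/
theorem exists_sign_of_isProductOne (x : ι → DihedralGroup n) (s : Finset ι)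
    (h : IsProductOne (s.val.map x)) :
    ∃ ε : ι → ℤ, (∀ i, ε i = 1 ∨ ε i = -1) ∧ ∑ i ∈ s, ε i * reflInd (x i) = 0 ∧
      ∑ i ∈ s, (ε i : ZMod n) * dihIdx (x i) = 0 := by
  classical
  obtain ⟨l, hl, h1⟩ := h
  obtain ⟨l', hs, rfl⟩ := exists_list_map_eq x s.val l hl
  have hnd : l'.Nodup := by rw [← Multiset.coe_nodup, hs]; exact s.nodup
  obtain ⟨ε, hε, h2, h3⟩ := exists_sign_list x l' hnd
  refine ⟨ε, hε, ?_, ?_⟩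
  · rw [Finset.sum, ← hs, Multiset.map_coe, Multiset.sum_coe, h2, h1]
    simp
  · rw [Finset.sum, ← hs, Multiset.map_coe, Multiset.sum_coe, h3, h1]
    simp

theorem eq_r_of_reflInd {g : DihedralGroup n} (h : reflInd g ≠ 1) : g = .r (dihIdx g) := by
  rcases g with i | i
  · rfl
  · simp [reflInd] at h

theorem eq_sr_of_reflInd {g : DihedralGroup n} (h : reflInd g = 1) : g = .sr (dihIdx g) := by
  rcases g with i | i
  · simp [reflInd] at h
  · rfl

theorem reflInd_eq_zero_or_one (g : DihedralGroup n) : reflInd g = 0 ∨ reflInd g = 1 := by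
  rcases g with i | i <;> simp [reflInd]

theorem list_prod_rotations (x : ι → DihedralGroup n) (l : List ι)
    (h : ∀ i ∈ l, reflInd (x i) ≠ 1) :
    (l.map x).prod = .r (l.map fun i => dihIdx (x i)).sum := by
  induction l with
  | nil => simp
  | cons a l ih =>
    rw [List.map_cons, List.prod_cons, ih fun i hi => h i (by simp [hi]),
      eq_r_of_reflInd (h a (by simp))]
    simp [dihIdx]

theorem isProductOne_rotations_iff (x : ι → DihedralGroup n) (s : Finset ι)
    (h : ∀ i ∈ s, reflInd (x i) ≠ 1) :
    IsProductOne (s.val.map x) ↔ ∑ i ∈ s, dihIdx (x i) = 0 := by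
  have key : ∀ l : List ι, (l : Multiset ι) = s.val →
      (l.map x).prod = .r (∑ i ∈ s, dihIdx (x i)) := by
    intro l hl
    rw [list_prod_rotations, Finset.sum, ← hl, Multiset.map_coe, Multiset.sum_coe]
    intro i hi
    apply h
    rw [← Finset.mem_val, ← hl]
    exact hi
  constructor
  · rintro ⟨l, hl, h1⟩
    obtain ⟨l', hs, rfl⟩ := exists_list_map_eq x s.val l hl
    rw [key l' hs, DihedralGroup.one_def] at h1
    exact DihedralGroup.r.inj h1
  · intro h0
    refine ⟨s.toList.map x, by rw [← Multiset.map_coe, Finset.coe_toList], ?_⟩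
    rw [key _ (Finset.coe_toList s), h0, DihedralGroup.one_def]

theorem exists_opposite_signs (x : ι → DihedralGroup n) (ε : ι → ℤ)
    (hε : ∀ i, ε i = 1 ∨ ε i = -1) (s : Finset ι) (h0 : ∑ i ∈ s, ε i * reflInd (x i) = 0)
    (hr : ∃ i ∈ s, reflInd (x i) = 1) :
    ∃ p ∈ s, ∃ m ∈ s, reflInd (x p) = 1 ∧ reflInd (x m) = 1 ∧ ε p = 1 ∧ ε m = -1 := by
  obtain ⟨i, hi, hi1⟩ := hr
  have aux : ∀ δ : ℤ, (δ = 1 ∨ δ = -1) → ∃ j ∈ s, reflInd (x j) = 1 ∧ ε j = δ := by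
    intro δ hδ
    by_contra! hno
    have hle : ∀ j ∈ s, 0 ≤ -δ * (ε j * reflInd (x j)) := by
      intro j hj
      have := hno j hj
      rcases reflInd_eq_zero_or_one (x j) with h | h
      · simp [h]
      · have := this h
        rcases hδ with rfl | rfl <;> rcases hε j with h' | h' <;> simp_all
    have hsum : ∑ j ∈ s, -δ * (ε j * reflInd (x j)) = 0 := by rw [← Finset.mul_sum, h0, mul_zero]
    have := (Finset.sum_eq_zero_iff_of_nonneg hle).1 hsum i hi
    rcases hδ with rfl | rfl <;> rcases hε i with h' | h' <;> simp_all
  obtain ⟨p, hp, hp1, hp2⟩ := aux 1 (by simp)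
  obtain ⟨m, hm, hm1, hm2⟩ := aux (-1) (by simp)
  exact ⟨p, hp, m, hm, hp1, hm1, hp2, hm2⟩

theorem exists_list_of_sign (x : ι → DihedralGroup n) (ε : ι → ℤ)
    (hε : ∀ i, ε i = 1 ∨ ε i = -1) (s : Finset ι) (h0 : ∑ i ∈ s, ε i * reflInd (x i) = 0)
    (hr : ∃ i ∈ s, reflInd (x i) = 1) :
    ∃ l : List (DihedralGroup n), (l : Multiset (DihedralGroup n)) = s.val.map x ∧
      l.prod = .r (∑ i ∈ s, (ε i : ZMod n) * dihIdx (x i)) := by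
  classical
  induction hc : s.card using Nat.strong_induction_on generalizing s with
  | _ k ih =>
    obtain ⟨p, hp, m, hm, hp1, hm1, hp2, hm2⟩ := exists_opposite_signs x ε hε s h0 hr
    have hpm : p ≠ m := by rintro rfl; omega
    obtain ⟨s', hs', rfl, hms⟩ : ∃ s', p ∉ insert m s' ∧ insert p (insert m s') = s ∧ m ∉ s' := by
      refine ⟨(s.erase p).erase m, by simp [hpm], ?_, by simp⟩
      rw [Finset.insert_erase (by simp [hm, hpm.symm]), Finset.insert_erase hp]
    rw [Finset.sum_insert hs', Finset.sum_insert hms] at h0 ⊢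
    rw [Finset.insert_val_of_notMem hs', Finset.insert_val_of_notMem hms]
    simp only [hp1, hm1, hp2, hm2] at h0 ⊢
    have hxp := eq_sr_of_reflInd hp1
    have hxm := eq_sr_of_reflInd hm1
    by_cases hr' : ∃ i ∈ s', reflInd (x i) = 1
    · obtain ⟨l, hl, hl'⟩ := ih s'.card (by
        rw [← hc, Finset.card_insert_of_notMem hs', Finset.card_insert_of_notMem hms]; omega)
        s' (by linarith) hr' rfl
      refine ⟨x m :: x p :: l, ?_, ?_⟩
      · rw [← Multiset.cons_coe, ← Multiset.cons_coe, hl, Multiset.map_cons, Multiset.map_cons,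
          Multiset.cons_swap]
      · rw [List.prod_cons, List.prod_cons, hl', hxp, hxm]
        simp [dihIdx]
        ring
    · push Not at hr'
      set P := s'.filter fun i => ε i = 1
      set M := s'.filter fun i => ¬ ε i = 1
      refine ⟨x m :: (M.toList.map x ++ x p :: P.toList.map x), ?_, ?_⟩
      · rw [← Multiset.cons_coe, ← Multiset.coe_add, ← Multiset.cons_coe, ← Multiset.map_coe,
          ← Multiset.map_coe, Finset.coe_toList, Finset.coe_toList, Multiset.map_cons,
          Multiset.map_cons, Multiset.add_cons, Multiset.cons_swap, ← Multiset.map_add]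
        congr 3
        rw [add_comm, Finset.filter_val, Finset.filter_val, Multiset.filter_add_not]
      · have e1 : ∀ t ⊆ s', (t.toList.map x).prod = .r (∑ i ∈ t, dihIdx (x i)) := by
          intro t ht
          rw [list_prod_rotations, Finset.sum_map_toList]
          intro i hi
          exact hr' i (ht (by simpa using hi))
        rw [List.prod_cons, List.prod_append, List.prod_cons, e1 _ (Finset.filter_subset _ _),
          e1 _ (Finset.filter_subset _ _), hxp, hxm]
        have hP : ∑ i ∈ P, dihIdx (x i) = ∑ i ∈ P, (ε i : ZMod n) * dihIdx (x i) :=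
          Finset.sum_congr rfl fun i hi => by simp [(Finset.mem_filter.1 hi).2]
        have hM : ∑ i ∈ M, dihIdx (x i) = -∑ i ∈ M, (ε i : ZMod n) * dihIdx (x i) := by
          rw [← Finset.sum_neg_distrib]
          refine Finset.sum_congr rfl fun i hi => ?_
          have := (hε i).resolve_left (Finset.mem_filter.1 hi).2
          simp [this]
        have hPM := Finset.sum_filter_add_sum_filter_not s' (fun i => ε i = 1)
          fun i => (ε i : ZMod n) * dihIdx (x i)
        rw [← hPM, hP, hM]
        simp [dihIdx]
        ring

/-- A sequence over a dihedral group that contains a reflection and has a zero signed sum is a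
product-one sequence. -/
theorem isProductOne_of_sign (x : ι → DihedralGroup n) (ε : ι → ℤ)
    (hε : ∀ i, ε i = 1 ∨ ε i = -1) (s : Finset ι) (h0 : ∑ i ∈ s, ε i * reflInd (x i) = 0)
    (h1 : ∑ i ∈ s, (ε i : ZMod n) * dihIdx (x i) = 0)
    (hr : ∃ i ∈ s, reflInd (x i) = 1) : IsProductOne (s.val.map x) := by
  obtain ⟨l, hl, hl'⟩ := exists_list_of_sign x ε hε s h0 hr
  exact ⟨l, hl, by rw [hl', h1, DihedralGroup.one_def]⟩

theorem even_sum_of_sign {s : Finset ι} {f ε : ι → ℤ} (hε : ∀ i, ε i = 1 ∨ ε i = -1) :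
    Even (∑ i ∈ s, ε i * f i) ↔ Even (∑ i ∈ s, f i) := by
  have : Even (∑ i ∈ s, ε i * f i - ∑ i ∈ s, f i) := by
    rw [← Finset.sum_sub_distrib]
    refine Finset.even_sum _ fun i _ => ?_
    rcases hε i with h | h
    · simp [h]
    · exact ⟨-f i, by rw [h]; ring⟩
  rw [Int.even_sub] at this
  exact this

theorem even_sum_reflInd (x : ι → DihedralGroup n) (s : Finset ι)
    (h : IsProductOne (s.val.map x)) : Even (∑ i ∈ s, reflInd (x i)) := by
  obtain ⟨ε, hε, h0, -⟩ := exists_sign_of_isProductOne x s h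
  rw [← even_sum_of_sign hε, h0]
  exact Even.zero

end Characterization

/-! ### Lengths of atoms and zero-sum free sequences -/

theorem exists_take_eq_take {α β : Type*} [DecidableEq β] (F : List α → β) (P : Finset β)
    (l : List α) (N : ℕ) (hP : ∀ j, F (l.take j) ∈ P) (hN : P.card ≤ N) :
    ∃ i j, i < j ∧ j ≤ N ∧ F (l.take i) = F (l.take j) := by
  obtain ⟨i, hi, j, hj, hij, h⟩ := Finset.exists_ne_map_eq_of_card_lt_of_maps_to
    (s := Finset.range (N + 1)) (t := P) (f := fun j => F (l.take j)) (by simp; omega)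
    (fun j _ => hP j)
  simp only [Finset.mem_range] at hi hj
  rcases lt_or_gt_of_ne hij with hlt | hlt
  · exact ⟨i, j, hlt, by omega, h⟩
  · exact ⟨j, i, hlt, by omega, h.symm⟩

/-- An atom over a finite group with all terms in a subgroup `H` has at most `|H|` terms. -/
theorem card_le_of_isAtomSeq {G : Type*} [Group G] [Finite G] (H : Subgroup G) {S : Multiset G}
    (hS : IsAtomSeq S) (hH : ∀ g ∈ S, g ∈ H) : Multiset.card S ≤ Nat.card H := by
  classical
  obtain ⟨h0, ⟨l, rfl, hl⟩, hat⟩ := hS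
  by_contra! hlt
  rw [Multiset.coe_card] at hlt
  have : Fintype G := Fintype.ofFinite G
  obtain ⟨i, j, hij, hj, he⟩ := exists_take_eq_take List.prod (Finset.univ.filter (· ∈ H)) l
    (l.length - 1) (fun j => by
      simp only [Finset.mem_filter, Finset.mem_univ, true_and]
      exact list_prod_mem fun g hg => hH g (by simpa using List.mem_of_mem_take hg))
    (by
      have : (Finset.univ.filter (· ∈ H)).card = Nat.card H := by
        rw [Nat.card_eq_fintype_card, ← Fintype.card_coe]
        exact Fintype.card_congr (Equiv.subtypeEquivRight (by simp))
      omega)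
  have hsplit : l = l.take i ++ ((l.take j).drop i ++ l.drop j) := by
    rw [← List.append_assoc]
    conv_lhs => rw [← List.take_append_drop j l]
    congr 1
    conv_lhs => rw [← List.take_append_drop i (l.take j)]
    rw [List.take_take, min_eq_left hij.le]
  have hmid : ((l.take j).drop i).prod = 1 := by
    have h2 : (l.take i).prod * ((l.take j).drop i).prod = (l.take j).prod := by
      rw [← List.prod_append]
      congr 1
      conv_rhs => rw [← List.take_append_drop i (l.take j)]
      rw [List.take_take, min_eq_left hij.le]
    rw [← he] at h2
    simpa using h2
  have hrest : (l.take i ++ l.drop j).prod = 1 := by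
    rw [List.prod_append, he, ← List.prod_append, List.take_append_drop, hl]
  have := hat ((l.take j).drop i) (l.take i ++ l.drop j : List G) (by
    conv_lhs => rw [hsplit]
    rw [Multiset.coe_add, Multiset.coe_eq_coe]
    rw [← List.append_assoc, ← List.append_assoc]
    exact List.Perm.append_right _ List.perm_append_comm) ⟨_, rfl, hmid⟩ ⟨_, rfl, hrest⟩
  rcases this with h | h
  · have := congrArg Multiset.card h
    simp at this
    omega
  · have := congrArg Multiset.card h
    simp at this
    omega

theorem exists_le_sum_mem {Q : Type*} [AddCommGroup Q] [Finite Q] (H : AddSubgroup Q)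
    (W : Multiset Q) (hW : H.index ≤ Multiset.card W) :
    ∃ B ≤ W, B ≠ 0 ∧ Multiset.card B ≤ H.index ∧ B.sum ∈ H := by
  classical
  have : Fintype (Q ⧸ H) := Fintype.ofFinite _
  obtain ⟨l, rfl⟩ := Quot.exists_rep W
  change H.index ≤ Multiset.card (l : Multiset Q) at hW
  rw [Multiset.coe_card] at hW
  obtain ⟨i, j, hij, hj, he⟩ := exists_take_eq_take
    (fun m : List Q => (QuotientAddGroup.mk m.sum : Q ⧸ H)) Finset.univ l H.index (by simp)
    (by rw [Finset.card_univ, ← Nat.card_eq_fintype_card]; rfl)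
  refine ⟨((l.take j).drop i : List Q), ?_, ?_, ?_, ?_⟩
  · exact ((List.drop_sublist _ _).trans (List.take_sublist _ _)).subperm
  · intro h
    have := congrArg Multiset.card h
    simp at this
    omega
  · simp; omega
  · have h2 : (l.take i).sum + ((l.take j).drop i).sum = (l.take j).sum := by
      rw [← List.sum_append]
      congr 1
      conv_rhs => rw [← List.take_append_drop i (l.take j)]
      rw [List.take_take, min_eq_left hij.le]
    rw [QuotientAddGroup.eq] at he
    rw [Multiset.sum_coe]
    rw [← h2] at he
    simpa using he

theorem le_cons_cases {α : Type*} {a : α} {T X : Multiset α} (h : T ≤ a ::ₘ X) :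
    T ≤ X ∨ ∃ T', T = a ::ₘ T' ∧ T' ≤ X := by
  by_cases ha : a ∈ T
  · obtain ⟨T', rfl⟩ := Multiset.exists_cons_of_mem ha
    exact Or.inr ⟨T', rfl, (Multiset.cons_le_cons_iff a).1 h⟩
  · exact Or.inl ((Multiset.le_cons_of_notMem ha).1 h)

/-- A zero-sum free sequence over a finite abelian group `Q` cannot have too many terms in a
subgroup `H`: each of them counts with multiplicity `[Q : H]`. -/
theorem zeroSumFree_bound {Q : Type*} [AddCommGroup Q] [Finite Q] (H : AddSubgroup Q)
    (Z W : Multiset Q) (hZ : ∀ z ∈ Z, z ∈ H)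
    (hfree : ∀ T ≤ Z + W, T.sum = 0 → T = 0) :
    H.index * Multiset.card Z + Multiset.card W + 1 ≤ Nat.card Q := by
  classical
  induction hc : Multiset.card W using Nat.strong_induction_on generalizing Z W with
  | _ k ih =>
    have hpos : 0 < H.index := Nat.pos_of_ne_zero AddSubgroup.FiniteIndex.index_ne_zero
    by_cases hk : H.index ≤ k
    · obtain ⟨B, hB, hB0, hBc, hBs⟩ := exists_le_sum_mem H W (hc ▸ hk)
      obtain ⟨W', rfl⟩ := Multiset.le_iff_exists_add.1 hB
      have hBpos := Multiset.card_pos.2 hB0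
      rw [Multiset.card_add] at hc
      have := ih (Multiset.card W') (by omega) (B.sum ::ₘ Z) W' (by
        intro z hz
        rcases Multiset.mem_cons.1 hz with rfl | hz
        · exact hBs
        · exact hZ z hz) (by
        intro T hT hT0
        rw [Multiset.cons_add] at hT
        rcases le_cons_cases hT with hT | ⟨T', rfl, hT'⟩
        · refine hfree T (hT.trans ?_) hT0
          rw [add_left_comm]
          exact Multiset.le_add_left _ _
        · rw [Multiset.sum_cons, ← Multiset.sum_add] at hT0
          have := hfree (B + T') (by rw [add_left_comm]; gcongr) hT0
          have := congrArg Multiset.card this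
          simp at this
          exact absurd this.1 hB0) rfl
      rw [Multiset.card_cons] at this
      nlinarith
    · have hZc : Multiset.card Z + 1 ≤ Nat.card H := by
        by_contra! hlt
        obtain ⟨Z', hZ'⟩ : ∃ Z' : Multiset H, Z'.map (↑) = Z := by
          lift Z to Multiset H using hZ
          exact ⟨Z, rfl⟩
        subst hZ'
        obtain ⟨B, hB, hB0, -, hBs⟩ := exists_le_sum_mem (⊥ : AddSubgroup H) Z' (by
          rw [AddSubgroup.index_bot]; simp at hlt; omega)
        have := hfree (B.map (↑)) ((Multiset.map_le_map hB).trans (Multiset.le_add_right _ _)) (by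
          have := congrArg (H.subtype) (AddSubgroup.mem_bot.1 hBs)
          rw [map_multiset_sum] at this
          simpa using this)
        exact hB0 (by simpa using this)
      have := H.index_mul_card
      nlinarith

/-! ### The lower bounds -/

section LowerBounds

variable {n : ℕ}

theorem list_prod_of_mem_pair (l : List (DihedralGroup n))
    (hl : ∀ g ∈ l, g = .r 1 ∨ g = .sr 0) :
    ∃ p m : ℕ, p + m = l.count (.r 1) ∧ l.length = l.count (.r 1) + l.count (.sr 0) ∧
      dihIdx l.prod = (p : ZMod n) - m ∧ (l.count (.sr 0) = 0 → m = 0) ∧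
      reflInd l.prod = (l.count (.sr 0) : ℤ) % 2 := by
  induction l with
  | nil => exact ⟨0, 0, by simp, by simp, by simp, by simp, by simp⟩
  | cons g l ih =>
    obtain ⟨p, m, h1, h2, h3, h4, h5⟩ := ih fun g hg => hl g (by simp [hg])
    rw [List.prod_cons]
    generalize l.prod = q at h3 h5 ⊢
    rcases hl g (by simp) with rfl | rfl
    · have e1 : (DihedralGroup.r (1 : ZMod n) :: l).count (.r 1) = l.count (.r 1) + 1 := by simp
      have e2 : (DihedralGroup.r (1 : ZMod n) :: l).count (.sr 0) = l.count (.sr 0) := by simp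
      rw [e1, e2, List.length_cons]
      rcases q with j | j
      · exact ⟨p + 1, m, by omega, by omega, by simp [dihIdx] at h3 ⊢; rw [h3]; ring, h4,
          by simpa [reflInd] using h5⟩
      · refine ⟨p, m + 1, by omega, by omega, by simp [dihIdx] at h3 ⊢; rw [h3]; ring, ?_,
          by simpa [reflInd] using h5⟩
        intro h
        simp [reflInd, h] at h5
    · have e1 : (DihedralGroup.sr (0 : ZMod n) :: l).count (.r 1) = l.count (.r 1) := by simp
      have e2 : (DihedralGroup.sr (0 : ZMod n) :: l).count (.sr 0) = l.count (.sr 0) + 1 := by simp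
      rw [e1, e2, List.length_cons]
      rcases q with j | j
      · refine ⟨p, m, by omega, by omega, by simpa [dihIdx] using h3, by simp, ?_⟩
        simp [reflInd] at h5 ⊢
        omega
      · refine ⟨p, m, by omega, by omega, by simpa [dihIdx] using h3, by simp, ?_⟩
        simp [reflInd] at h5 ⊢
        omega

/-- The atom `(r 1)^(2n-2) (sr 0)^2` of maximal length. -/
def longAtom (n : ℕ) : Multiset (DihedralGroup n) :=
  Multiset.replicate (2 * n - 2) (.r 1) + Multiset.replicate 2 (.sr 0)

theorem count_r_longAtom : (longAtom n).count (.r 1) = 2 * n - 2 := by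
  simp [longAtom]

theorem count_sr_longAtom : (longAtom n).count (.sr 0) = 2 := by
  simp [longAtom, Multiset.count_replicate]

theorem mem_longAtom {g : DihedralGroup n} (h : g ∈ longAtom n) : g = .r 1 ∨ g = .sr 0 := by
  simp only [longAtom, Multiset.mem_add] at h
  exact h.imp Multiset.eq_of_mem_replicate Multiset.eq_of_mem_replicate

theorem card_longAtom (hn : 3 ≤ n) : Multiset.card (longAtom n) = 2 * n := by
  simp [longAtom]
  omega

theorem isAtomSeq_longAtom (hn : 3 ≤ n) (hodd : Odd n) : IsAtomSeq (longAtom n) := by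
  refine ⟨?_, ?_, ?_⟩
  · intro h
    have := card_longAtom hn
    rw [h] at this
    simp at this
    omega
  · refine ⟨.sr 0 :: (List.replicate (n - 1) (.r 1) ++
      .sr 0 :: List.replicate (n - 1) (.r 1)), ?_, ?_⟩
    · rw [longAtom, ← Multiset.cons_coe, ← Multiset.coe_add, ← Multiset.cons_coe,
        Multiset.coe_replicate, Multiset.add_cons, ← Multiset.replicate_add,
        show n - 1 + (n - 1) = 2 * n - 2 by omega, show 2 = 1 + 1 from rfl,
        Multiset.replicate_succ, Multiset.replicate_one, Multiset.add_cons, add_comm _ {_},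
        Multiset.singleton_add]
    · simp
  · have key : ∀ S : Multiset (DihedralGroup n), IsProductOne S →
        (∀ g ∈ S, g = .r 1 ∨ g = .sr 0) →
        Multiset.card S = S.count (.r 1) + S.count (.sr 0) ∧ Even (S.count (.sr 0)) ∧
        ∃ p m : ℕ, p + m = S.count (.r 1) ∧ (p : ZMod n) = m ∧ (S.count (.sr 0) = 0 → m = 0) := by
      rintro _ ⟨l, rfl, h⟩ hS
      obtain ⟨p, m, h1, h2, h3, h4, h5⟩ := list_prod_of_mem_pair l (by simpa using hS)
      rw [h] at h3 h5
      simp only [Multiset.coe_card, Multiset.coe_count]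
      refine ⟨h2, ?_, p, m, h1, ?_, h4⟩
      · rw [← Int.even_coe_nat, Int.even_iff, ← h5]
        simp
      · rw [dihIdx_one] at h3
        exact (sub_eq_zero.1 h3.symm)
    have main : ∀ A B : Multiset (DihedralGroup n), longAtom n = A + B → IsProductOne A →
        IsProductOne B → A.count (.sr 0) = 0 → A = 0 := by
      intro A B h hA hB h0
      obtain ⟨a1, a2, p, m, a3, a4, a5⟩ := key A hA fun g hg =>
        mem_longAtom (by rw [h]; simp [hg])
      obtain ⟨b1, b2, p', m', b3, b4, -⟩ := key B hB fun g hg =>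
        mem_longAtom (by rw [h]; simp [hg])
      have hc := count_r_longAtom (n := n)
      rw [h, Multiset.count_add] at hc
      obtain rfl := a5 h0
      rw [Nat.cast_zero, ZMod.natCast_eq_zero_iff] at a4
      obtain ⟨c, rfl⟩ := a4
      rcases Nat.lt_or_ge c 1 with hc1 | hc1
      · obtain rfl : c = 0 := by omega
        rw [← Multiset.card_eq_zero]
        omega
      rcases Nat.lt_or_ge c 2 with hc2 | hc2
      · obtain rfl : c = 1 := by omega
        rw [ZMod.natCast_eq_natCast_iff'] at b4
        rw [Nat.mod_eq_of_lt (by omega), Nat.mod_eq_of_lt (by omega)] at b4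
        obtain ⟨k, hk⟩ := hodd
        omega
      · have : n * 2 ≤ n * c := Nat.mul_le_mul_left n hc2
        omega
    intro A B h hA hB
    have hc := count_sr_longAtom (n := n)
    rw [h, Multiset.count_add] at hc
    obtain ⟨-, a2, -⟩ := key A hA fun g hg => mem_longAtom (by rw [h]; simp [hg])
    obtain ⟨-, b2, -⟩ := key B hB fun g hg => mem_longAtom (by rw [h]; simp [hg])
    rcases Nat.eq_zero_or_pos (A.count (.sr 0)) with h0 | h0
    · exact Or.inl (main A B h hA hB h0)
    · refine Or.inr (main B A (by rw [h, add_comm]) hB hA ?_)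
      obtain ⟨k, hk⟩ := a2
      omega

theorem davenport_dihedral (hn : 3 ≤ n) (hodd : Odd n) : Davenport (DihedralGroup n) = 2 * n := by
  have : NeZero n := ⟨by omega⟩
  refine IsGreatest.csSup_eq ⟨⟨longAtom n, ⟨fun _ _ => Set.mem_univ _,
    isAtomSeq_longAtom hn hodd⟩, card_longAtom hn⟩, ?_⟩
  rintro k ⟨S, ⟨-, hS⟩, rfl⟩
  have := card_le_of_isAtomSeq ⊤ hS (by simp)
  rwa [Subgroup.card_top, DihedralGroup.nat_card] at this

theorem two_mul_le_omegaInv (hn : 3 ≤ n) (hodd : Odd n) :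
    ((2 * n : ℕ) : ℕ∞) ≤ omegaInv (DihedralGroup n) := by
  have : NeZero n := ⟨by omega⟩
  have : Fact (2 < n) := ⟨by omega⟩
  have : Fact (1 < n) := ⟨by omega⟩
  refine le_trans ?_ (le_iSup₂_of_le (longAtom n) (isAtomSeq_longAtom hn hodd) le_rfl)
  refine le_sInf fun N hN => ?_
  set X : Multiset (DihedralGroup n) := {.r 1, .r (-1)}
  set Y : Multiset (DihedralGroup n) := {.sr 0, .sr 1, .r (-1)}
  obtain ⟨t, ht, htN, C, hC, hC'⟩ := hN (Multiset.replicate (2 * n - 2) X + Multiset.replicate 2 Y)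
    (by
      intro B hB
      rw [Multiset.mem_add] at hB
      rcases hB with hB | hB
      · rw [Multiset.eq_of_mem_replicate hB]
        exact ⟨[.r 1, .r (-1)], rfl, by simp⟩
      · rw [Multiset.eq_of_mem_replicate hB]
        exact ⟨[.sr 0, .sr 1, .r (-1)], rfl, by simp⟩)
    (by
      refine ⟨Multiset.replicate (2 * n) (.r (-1)) + Multiset.replicate 2 (.sr 1), ?_, ?_⟩
      · refine ⟨.sr 1 :: .sr 1 :: List.replicate (2 * n) (.r (-1)), ?_, ?_⟩
        · rw [← Multiset.cons_coe, ← Multiset.cons_coe, Multiset.coe_replicate, add_comm]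
          simp [Multiset.replicate_succ]
        · simp [DihedralGroup.r_pow]
      · ext g
        simp only [Multiset.sum_add, Multiset.sum_replicate, longAtom, Multiset.count_add,
          Multiset.count_nsmul, Multiset.count_replicate, X, Y, Multiset.insert_eq_cons,
          Multiset.count_cons, Multiset.count_singleton, eq_comm (a := g)]
        split_ifs <;> omega)
  obtain ⟨u, hu⟩ := Multiset.le_iff_exists_add.1 ht
  have hne : (DihedralGroup.r (-1) : DihedralGroup n) ≠ .r 1 := by
    simpa using ZMod.neg_one_ne_one (n := n)
  have c1 : (t + u).sum.count (.r 1) = 2 * n - 2 := by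
    rw [← hu]
    simp [X, Y, Multiset.sum_replicate, hne.symm]
  have c2 : (t + u).sum.count (.sr 0) = 2 := by
    rw [← hu]
    simp [X, Y, Multiset.sum_replicate]
  rw [Multiset.sum_add, hC', Multiset.count_add, Multiset.count_add] at c1 c2
  rw [count_r_longAtom] at c1
  rw [count_sr_longAtom] at c2
  have hu0 : u = 0 := by
    rw [Multiset.eq_zero_iff_forall_notMem]
    intro B hB
    have hBu := Multiset.single_le_sum (s := u) (fun _ _ => zero_le) B hB
    have hBf : B ∈ Multiset.replicate (2 * n - 2) X + Multiset.replicate 2 Y := by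
      rw [hu]; exact Multiset.mem_add.2 (Or.inr hB)
    rw [Multiset.mem_add] at hBf
    rcases hBf with hB' | hB'
    · have h1 : (DihedralGroup.r 1 : DihedralGroup n) ∈ u.sum :=
        Multiset.mem_of_le hBu (by rw [Multiset.eq_of_mem_replicate hB']; simp [X])
      have := Multiset.count_pos.2 h1
      omega
    · have h1 : (DihedralGroup.sr 0 : DihedralGroup n) ∈ u.sum :=
        Multiset.mem_of_le hBu (by rw [Multiset.eq_of_mem_replicate hB']; simp [Y])
      have := Multiset.count_pos.2 h1
      omega
  have hcard : Multiset.card t = 2 * n := by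
    have := congrArg Multiset.card hu
    rw [hu0] at this
    simp at this
    omega
  rwa [hcard] at htN

end LowerBounds

/-! ### Growth of subset sums -/

section Growth

open scoped Pointwise

variable {Q : Type*} [AddCommGroup Q] [DecidableEq Q] {ι : Type*}

/-- All sums `b + ∑ i ∈ Y, g i` with `b ∈ B` and `Y ⊆ A`. -/
def shiftedSums (B : Finset Q) (g : ι → Q) (A : Finset ι) : Finset Q :=
  (B ×ˢ A.powerset).image fun p => p.1 + ∑ i ∈ p.2, g i

theorem mem_shiftedSums {B : Finset Q} {g : ι → Q} {A : Finset ι} {z : Q} :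
    z ∈ shiftedSums B g A ↔ ∃ b ∈ B, ∃ Y ⊆ A, b + ∑ i ∈ Y, g i = z := by
  simp only [shiftedSums, Finset.mem_image, Finset.mem_product, Finset.mem_powerset, Prod.exists]
  constructor
  · rintro ⟨b, Y, ⟨hb, hY⟩, h⟩
    exact ⟨b, hb, Y, hY, h⟩
  · rintro ⟨b, hb, Y, hY, h⟩
    exact ⟨b, Y, ⟨hb, hY⟩, h⟩

theorem shiftedSums_mono {B : Finset Q} {g : ι → Q} {A A' : Finset ι} (h : A ⊆ A') :
    shiftedSums B g A ⊆ shiftedSums B g A' := by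
  intro z hz
  obtain ⟨b, hb, Y, hY, rfl⟩ := mem_shiftedSums.1 hz
  exact mem_shiftedSums.2 ⟨b, hb, Y, hY.trans h, rfl⟩

theorem subset_shiftedSums {B : Finset Q} {g : ι → Q} {A : Finset ι} :
    B ⊆ shiftedSums B g A := fun b hb =>
  mem_shiftedSums.2 ⟨b, hb, ∅, Finset.empty_subset _, by simp⟩

/-- The stabilizer of a finite subset of an abelian group. -/
def stabAdd (T : Finset Q) : AddSubgroup Q := AddAction.stabilizer Q T

theorem mem_stabAdd {T : Finset Q} {z : Q} : z ∈ stabAdd T ↔ ∀ t ∈ T, t + z ∈ T := by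
  rw [stabAdd, AddAction.mem_stabilizer_finset']
  simp only [vadd_eq_add, add_comm z]

theorem stabAdd_le_stabAdd_shiftedSums (B : Finset Q) (g : ι → Q) (A : Finset ι) :
    stabAdd B ≤ stabAdd (shiftedSums B g A) := by
  intro z hz
  rw [mem_stabAdd] at hz ⊢
  intro t ht
  obtain ⟨b, hb, Y, hY, rfl⟩ := mem_shiftedSums.1 ht
  exact mem_shiftedSums.2 ⟨b + z, hz b hb, Y, hY, by abel⟩

theorem shiftedSums_union [DecidableEq ι] (B : Finset Q) (g : ι → Q) {A A' : Finset ι}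
    (h : Disjoint A A') :
    shiftedSums B g (A ∪ A') = shiftedSums (shiftedSums B g A) g A' := by
  ext z
  constructor
  · intro hz
    obtain ⟨b, hb, Y, hY, rfl⟩ := mem_shiftedSums.1 hz
    refine mem_shiftedSums.2 ⟨b + ∑ i ∈ Y ∩ A, g i, mem_shiftedSums.2
      ⟨b, hb, _, Finset.inter_subset_right, rfl⟩, Y \ A, ?_, ?_⟩
    · intro i hi
      rw [Finset.mem_sdiff] at hi
      exact (Finset.mem_union.1 (hY hi.1)).resolve_left hi.2
    · rw [add_assoc, Finset.sum_inter_add_sum_sdiff]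
  · intro hz
    obtain ⟨_, hc, Y', hY', rfl⟩ := mem_shiftedSums.1 hz
    obtain ⟨b, hb, Y, hY, rfl⟩ := mem_shiftedSums.1 hc
    refine mem_shiftedSums.2 ⟨b, hb, Y ∪ Y', Finset.union_subset_union hY hY', ?_⟩
    rw [Finset.sum_union (Finset.disjoint_of_subset_left hY
      (Finset.disjoint_of_subset_right hY' h)), add_assoc]

theorem shiftedSums_insert_eq [DecidableEq ι] {B : Finset Q} {g : ι → Q} {A : Finset ι} {a : ι}
    (ha : a ∉ A) (hg : g a ∈ stabAdd (shiftedSums B g A)) :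
    shiftedSums B g (insert a A) = shiftedSums B g A := by
  refine (Finset.Subset.antisymm (shiftedSums_mono (Finset.subset_insert _ _)) ?_).symm
  rw [← Finset.union_singleton, shiftedSums_union _ _ (by simpa using ha)]
  intro z hz
  obtain ⟨b, hb, Y, hY, rfl⟩ := mem_shiftedSums.1 hz
  rcases Finset.subset_singleton_iff.1 hY with rfl | rfl
  · simpa using hb
  · simpa using mem_stabAdd.1 hg b hb

theorem card_add_mul_le_card_shiftedSums [DecidableEq ι] [Finite Q] (H : AddSubgroup Q)
    (B : Finset Q) (g : ι → Q) (A : Finset ι) (hB : H ≤ stabAdd B)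
    (hgrow : ∀ A' ⊆ A, ∀ a ∈ A, a ∉ A' → g a ∉ stabAdd (shiftedSums B g A')) :
    B.card + A.card * Nat.card H ≤ (shiftedSums B g A).card := by
  classical
  have : Fintype Q := Fintype.ofFinite Q
  induction A using Finset.induction_on with
  | empty => simpa using Finset.card_le_card subset_shiftedSums
  | insert a A ha ih =>
    have h1 := ih fun A' hA' b hb => hgrow A' (hA'.trans (Finset.subset_insert _ _)) b
      (Finset.mem_insert_of_mem hb)
    have h2 := hgrow A (Finset.subset_insert _ _) a (Finset.mem_insert_self _ _) ha
    rw [mem_stabAdd] at h2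
    push Not at h2
    obtain ⟨t, ht, ht'⟩ := h2
    set K := shiftedSums B g A
    set K' := shiftedSums B g (insert a A)
    have hK : H ≤ stabAdd K := hB.trans (stabAdd_le_stabAdd_shiftedSums _ _ _)
    have hK' : H ≤ stabAdd K' := hB.trans (stabAdd_le_stabAdd_shiftedSums _ _ _)
    have htK' : t + g a ∈ K' := by
      have e : K' = shiftedSums K g {a} := by
        rw [← shiftedSums_union _ _ (by simpa using ha), Finset.union_singleton]
      rw [e]
      exact mem_shiftedSums.2 ⟨t, ht, {a}, subset_rfl, by simp⟩
    let C := (Finset.univ.filter (· ∈ H)).image fun z => (t + g a) + z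
    have hC : C.card = Nat.card H := by
      rw [Finset.card_image_of_injective _ (add_right_injective _), Nat.card_eq_fintype_card,
        ← Fintype.card_coe]
      exact Fintype.card_congr (Equiv.subtypeEquivRight (by simp))
    have hdisj : Disjoint K C := by
      rw [Finset.disjoint_left]
      intro z hz hzC
      obtain ⟨y, hy, rfl⟩ := Finset.mem_image.1 hzC
      have hy' : -y ∈ H := H.neg_mem (by simpa using hy)
      have := mem_stabAdd.1 (hK hy') _ hz
      exact ht' (by simpa using this)
    have hsub : K ∪ C ⊆ K' := by
      refine Finset.union_subset (shiftedSums_mono (Finset.subset_insert _ _)) ?_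
      intro z hz
      obtain ⟨y, hy, rfl⟩ := Finset.mem_image.1 hz
      exact mem_stabAdd.1 (hK' (by simpa using hy)) _ htK'
    have h3 := Finset.card_le_card hsub
    rw [Finset.card_union_of_disjoint hdisj, hC] at h3
    rw [Finset.card_insert_of_notMem ha, add_mul, one_mul]
    omega

/-- If no combination of base terms `g` on `F` and special terms `h` on `S` that uses a special
term has sum zero, then, up to trimming `F`, the number of special terms and the number of base
terms outside the stabilizer `H` of the set of subset sums are bounded by `|Q| / |H|`. -/
theorem exists_trim_of_zeroSumFree [Finite Q] {κ : Type*} (F : Finset ι) (g : ι → Q)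
    (S : Finset κ) (h : κ → Q)
    (hfree : ∀ Y ⊆ F, ∀ X ⊆ S, ∑ i ∈ Y, g i + ∑ i ∈ X, h i = 0 → X = ∅) :
    ∃ F' ⊆ F, shiftedSums {0} g F' = shiftedSums {0} g F ∧ ∃ o e : ℕ, F'.card = o + e ∧
      e + 1 ≤ Nat.card (stabAdd (shiftedSums {0} g F)) ∧
      (o + 1 + S.card) * Nat.card (stabAdd (shiftedSums {0} g F)) ≤ Nat.card Q := by
  classical
  have : Fintype Q := Fintype.ofFinite Q
  set T := shiftedSums {0} g F with hT
  set H := stabAdd T with hH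
  obtain ⟨F', hF', hmin⟩ := Finset.exists_min_image
    (F.powerset.filter fun A => shiftedSums {0} g A = T) Finset.card ⟨F, by simp [hT]⟩
  simp only [Finset.mem_filter, Finset.mem_powerset] at hF' hmin
  obtain ⟨hF'F, hF'T⟩ := hF'
  have h0T : (0 : Q) ∈ T := subset_shiftedSums (Finset.mem_singleton_self 0)
  refine ⟨F', hF'F, hF'T, (F'.filter (g · ∉ H)).card, (F'.filter (g · ∈ H)).card, ?_, ?_, ?_⟩
  · rw [add_comm, Finset.card_filter_add_card_filter_not]
  · have hgr := card_add_mul_le_card_shiftedSums (⊥ : AddSubgroup Q) {0} g (F'.filter (g · ∈ H))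
      bot_le (by
        intro A' hA' a ha haA' hst
        have haF' := (Finset.mem_filter.1 ha).1
        have hA'F' : A' ⊆ F'.erase a := fun i hi => Finset.mem_erase.2
          ⟨by rintro rfl; exact haA' hi, (Finset.mem_filter.1 (hA' hi)).1⟩
        have hst' : g a ∈ stabAdd (shiftedSums {0} g (F'.erase a)) := by
          have := stabAdd_le_stabAdd_shiftedSums _ g (F'.erase a \ A') hst
          rwa [← shiftedSums_union _ _ Finset.disjoint_sdiff, Finset.union_sdiff_of_subset hA'F']
            at this
        have he := shiftedSums_insert_eq (Finset.notMem_erase a F') hst'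
        rw [Finset.insert_erase haF', hF'T] at he
        have := hmin (F'.erase a) ⟨(Finset.erase_subset _ _).trans hF'F, he.symm⟩
        have := Finset.card_erase_lt_of_mem haF'
        omega)
    have hsub : shiftedSums {0} g (F'.filter (g · ∈ H)) ⊆ Finset.univ.filter (· ∈ H) := by
      intro z hz
      obtain ⟨b, hb, Y, hY, rfl⟩ := mem_shiftedSums.1 hz
      rw [Finset.mem_singleton.1 hb, zero_add]
      simp only [Finset.mem_filter, Finset.mem_univ, true_and]
      exact H.sum_mem fun i hi => (Finset.mem_filter.1 (hY hi)).2
    have hcard : (Finset.univ.filter (· ∈ H)).card = Nat.card H := by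
      rw [Nat.card_eq_fintype_card, ← Fintype.card_coe]
      exact Fintype.card_congr (Equiv.subtypeEquivRight (by simp))
    have := Finset.card_le_card hsub
    simp only [AddSubgroup.card_bot, mul_one, Finset.card_singleton] at hgr
    omega
  · set HF : Finset Q := Finset.univ.filter (· ∈ H) with hHF
    have hcard : HF.card = Nat.card H := by
      rw [Nat.card_eq_fintype_card, ← Fintype.card_coe]
      exact Fintype.card_congr (Equiv.subtypeEquivRight (by simp [HF]))
    have hper : H ≤ stabAdd HF := by
      intro z hz
      rw [mem_stabAdd]
      intro t ht
      simp only [HF, Finset.mem_filter, Finset.mem_univ, true_and] at ht ⊢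
      exact H.add_mem ht hz
    set O := F'.filter (g · ∉ H)
    have hfull : ∀ A ⊆ F', shiftedSums HF g A ⊆ T := by
      intro A hA z hz
      obtain ⟨b, hb, Y, hY, rfl⟩ := mem_shiftedSums.1 hz
      have hb' : b ∈ H := by simpa [HF] using hb
      have : ∑ i ∈ Y, g i ∈ T := by
        rw [← hF'T]
        exact mem_shiftedSums.2 ⟨0, by simp, Y, hY.trans hA, by simp⟩
      rw [add_comm]
      exact mem_stabAdd.1 hb' _ this
    have hgr := card_add_mul_le_card_shiftedSums H HF g O hper (by
      intro A' hA' a ha haA' hst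
      have hA'F' : A' ⊆ F' := hA'.trans (Finset.filter_subset _ _)
      have hst' := stabAdd_le_stabAdd_shiftedSums _ g (F' \ A') hst
      rw [← shiftedSums_union _ _ Finset.disjoint_sdiff, Finset.union_sdiff_of_subset hA'F'] at hst'
      have : shiftedSums HF g F' = T := by
        refine Finset.Subset.antisymm (hfull F' subset_rfl) ?_
        rw [← hF'T]
        intro z hz
        obtain ⟨b, hb, Y, hY, rfl⟩ := mem_shiftedSums.1 hz
        refine mem_shiftedSums.2 ⟨b, ?_, Y, hY, rfl⟩
        rw [Finset.mem_singleton.1 hb]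
        simp [HF, H.zero_mem]
      rw [this] at hst'
      exact (Finset.mem_filter.1 ha).2 hst')
    have hT1 := Finset.card_le_card (hfull O (Finset.filter_subset _ _))
    have hgr2 := card_add_mul_le_card_shiftedSums H T h S le_rfl (by
      intro A' hA' a ha haA' hst
      have h0 : (0 : Q) ∈ shiftedSums T h A' := subset_shiftedSums h0T
      have h1 := mem_stabAdd.1 (AddSubgroup.neg_mem _ hst) _ h0
      rw [zero_add] at h1
      obtain ⟨b, hb, X, hX, he⟩ := mem_shiftedSums.1 h1
      obtain ⟨c, hc, Y, hY, rfl⟩ := mem_shiftedSums.1 hb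
      rw [Finset.mem_singleton.1 hc, zero_add] at he
      have haX : a ∉ X := fun hh => haA' (hX hh)
      have := hfree Y hY (insert a X) (Finset.insert_subset ha (hX.trans hA')) (by
        rw [Finset.sum_insert haX, add_left_comm, he]; simp)
      simp at this)
    have hQ := Finset.card_le_univ (shiftedSums T h S)
    rw [← Nat.card_eq_fintype_card] at hQ
    rw [hcard] at hgr
    calc _ = Nat.card H + O.card * Nat.card H + S.card * Nat.card H := by ring
      _ ≤ T.card + S.card * Nat.card H := by omega
      _ ≤ _ := by omega

end Growth

/-! ### Terms of an atom in a dihedral subgroup -/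

theorem exists_finset_of_map_eq_add {ι α : Type*} [DecidableEq ι] (x : ι → α) (s : Finset ι)
    (A B : Multiset α) (h : s.val.map x = A + B) :
    ∃ t ⊆ s, t.val.map x = A ∧ (s \ t).val.map x = B := by
  classical
  induction s using Finset.induction_on generalizing A B with
  | empty =>
    rw [Finset.empty_val, Multiset.map_zero, eq_comm, add_eq_zero] at h
    exact ⟨∅, subset_rfl, by simp [h.1], by simp [h.2]⟩
  | insert a s ha ih =>
    rw [Finset.insert_val_of_notMem ha, Multiset.map_cons] at h
    have hmem : x a ∈ A + B := by rw [← h]; simp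
    rcases Multiset.mem_add.1 hmem with hA | hB
    · obtain ⟨A', rfl⟩ := Multiset.exists_cons_of_mem hA
      rw [Multiset.cons_add, Multiset.cons_inj_right] at h
      obtain ⟨t, hts, h1, h2⟩ := ih A' B h
      have hat : a ∉ t := fun hh => ha (hts hh)
      refine ⟨insert a t, Finset.insert_subset_insert _ hts, ?_, ?_⟩
      · rw [Finset.insert_val_of_notMem hat, Multiset.map_cons, h1]
      · rw [← h2]
        congr 2
        ext i
        simp only [Finset.mem_sdiff, Finset.mem_insert]
        constructor
        · rintro ⟨h | h, h'⟩ <;> tauto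
        · rintro ⟨h, h'⟩
          exact ⟨Or.inr h, by rintro (rfl | h); exacts [ha ‹_›, h' h]⟩
    · obtain ⟨B', rfl⟩ := Multiset.exists_cons_of_mem hB
      rw [Multiset.add_cons, Multiset.cons_inj_right] at h
      obtain ⟨t, hts, h1, h2⟩ := ih A B' h
      have hat : a ∉ t := fun hh => ha (hts hh)
      refine ⟨t, hts.trans (Finset.subset_insert _ _), h1, ?_⟩
      rw [Finset.insert_sdiff_of_notMem _ hat, Finset.insert_val_of_notMem (by simp [ha]),
        Multiset.map_cons, h2]

theorem zeroSumFree_bound_finset {Q ι : Type*} [AddCommGroup Q] [Finite Q] [DecidableEq ι]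
    (H : AddSubgroup Q) (w : ι → Q) (Z W : Finset ι) (hd : Disjoint Z W) (hZ : ∀ i ∈ Z, w i ∈ H)
    (hfree : ∀ Y ⊆ Z ∪ W, ∑ i ∈ Y, w i = 0 → Y = ∅) :
    H.index * Z.card + W.card + 1 ≤ Nat.card Q := by
  have := zeroSumFree_bound H (Z.val.map w) (W.val.map w) (by
    intro z hz
    obtain ⟨i, hi, rfl⟩ := Multiset.mem_map.1 hz
    exact hZ i hi) (by
    intro T hT hT0
    obtain ⟨T', hT'⟩ := Multiset.le_iff_exists_add.1 hT
    rw [← Multiset.map_add, ← Finset.disjUnion_val Z W hd] at hT'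
    obtain ⟨Y, hY, rfl, -⟩ := exists_finset_of_map_eq_add w _ T T' hT'
    rw [Finset.disjUnion_eq_union] at hY
    rw [hfree Y hY hT0]
    simp)
  simpa using this

/-- Splitting an atom along an index set is trivial. -/
theorem IsAtomSeq.subset_trivial {G ι : Type*} [Group G] [DecidableEq ι] {x : ι → G}
    {U S : Finset ι} (hU : IsAtomSeq (U.val.map x)) (hS : S ⊆ U)
    (h1 : IsProductOne (S.val.map x)) (h2 : IsProductOne ((U \ S).val.map x)) :
    S = ∅ ∨ U \ S = ∅ := by
  have := hU.2.2 (S.val.map x) ((U \ S).val.map x) (by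
    rw [← Multiset.map_add, ← Finset.disjUnion_val _ _ Finset.disjoint_sdiff,
      Finset.disjUnion_eq_union, Finset.union_sdiff_of_subset hS]) h1 h2
  simpa only [Multiset.map_eq_zero, Finset.val_eq_zero] using this

theorem exists_bijection_of_card_eq {ι : Type*} [DecidableEq ι] {s t : Finset ι}
    (h : s.card = t.card) :
    ∃ e : ι → ι, Set.InjOn e s ∧ s.image e = t := by
  refine ⟨fun i => if hi : i ∈ s then (Finset.equivOfCardEq h ⟨i, hi⟩ : ι) else i, ?_, ?_⟩
  · intro i hi j hj hij
    rw [Finset.mem_coe] at hi hj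
    simp only [hi, hj, dite_true] at hij
    simpa using (Finset.equivOfCardEq h).injective (Subtype.ext hij)
  · ext j
    simp only [Finset.mem_image]
    constructor
    · rintro ⟨i, hi, rfl⟩
      simp [hi]
    · intro hj
      refine ⟨(Finset.equivOfCardEq h).symm ⟨j, hj⟩, Subtype.coe_prop _, ?_⟩
      simp

section AtomClass

variable {n : ℕ} {ι : Type*} [DecidableEq ι]

theorem atom_sign_bound [NeZero n] (x : ι → DihedralGroup n) (U : Finset ι)
    (hU : IsAtomSeq (U.val.map x)) (ε : ι → ℤ) (hε : ∀ i, ε i = 1 ∨ ε i = -1)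
    (h0 : ∑ i ∈ U, ε i * reflInd (x i) = 0) (h1 : ∑ i ∈ U, (ε i : ZMod n) * dihIdx (x i) = 0)
    (H : AddSubgroup (ZMod n)) (R DZ DW : Finset ι) (τ : ℤ) (hτ : τ = 1 ∨ τ = -1)
    (hR : ∀ i ∈ R, i ∈ U ∧ reflInd (x i) ≠ 1 ∧ dihIdx (x i) ∈ H ∧ ε i = τ)
    (e : ι → ι) (hdisj : Disjoint DZ DW) (he : Set.InjOn e (DZ ∪ DW : Finset ι))
    (hD : ∀ p ∈ DZ ∪ DW, p ∈ U ∧ reflInd (x p) = 1 ∧ ε p = 1)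
    (hD' : ∀ p ∈ DZ ∪ DW, e p ∈ U ∧ reflInd (x (e p)) = 1 ∧ ε (e p) = -1)
    (hDZ : ∀ p ∈ DZ, dihIdx (x p) - dihIdx (x (e p)) ∈ H)
    (i₀ : ι) (hi₀ : i₀ ∈ U) (hi₀r : reflInd (x i₀) = 1) (hi₀D : i₀ ∉ DZ ∪ DW)
    (hi₀e : ∀ p ∈ DZ ∪ DW, e p ≠ i₀) :
    H.index * (R.card + DZ.card) + DW.card + 1 ≤ n := by
  classical
  set D := DZ ∪ DW with hDdef
  have hRD : Disjoint R D := Finset.disjoint_left.2 fun i hi hi' => (hR i hi).2.1 (hD i hi').2.1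
  let w : ι → ZMod n := fun i => if reflInd (x i) = 1 then dihIdx (x i) - dihIdx (x (e i))
    else (ε i : ZMod n) * dihIdx (x i)
  have hwR : ∀ i ∈ R, w i = (ε i : ZMod n) * dihIdx (x i) := fun i hi => if_neg (hR i hi).2.1
  have hwD : ∀ i ∈ D, w i = dihIdx (x i) - dihIdx (x (e i)) := fun i hi => if_pos (hD i hi).2.1
  have hRDZ : Disjoint R DZ := Finset.disjoint_of_subset_right Finset.subset_union_left hRD
  have hRDW : Disjoint R DW := Finset.disjoint_of_subset_right Finset.subset_union_right hRD
  have := zeroSumFree_bound_finset H w (R ∪ DZ) DW (Finset.disjoint_union_left.2 ⟨hRDW, hdisj⟩)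
    (by
      intro i hi
      rcases Finset.mem_union.1 hi with hi | hi
      · rw [hwR i hi]
        rcases hε i with h | h
        · simpa [h] using (hR i hi).2.2.1
        · simpa [h] using (hR i hi).2.2.1
      · rw [hwD i (Finset.mem_union_left _ hi)]
        exact hDZ i hi)
    (by
      intro Y hY hY0
      rw [Finset.union_assoc, ← hDdef] at hY
      by_contra hne
      have hne := Finset.nonempty_iff_ne_empty.2 hne
      set YD := Y ∩ D
      set YR := Y ∩ R
      have hYeq : Y = YR ∪ YD := by
        rw [← Finset.inter_union_distrib_left, Finset.inter_eq_left.2 hY]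
      have hYRD : Disjoint YR YD := Finset.disjoint_of_subset_left Finset.inter_subset_right
        (Finset.disjoint_of_subset_right Finset.inter_subset_right hRD)
      have hYD : ∀ p ∈ YD, p ∈ D := fun p hp => (Finset.mem_inter.1 hp).2
      have hYR : ∀ p ∈ YR, p ∈ R := fun p hp => (Finset.mem_inter.1 hp).2
      have heYD : Set.InjOn e YD := he.mono (by intro p hp; exact hYD p hp)
      set P := YD ∪ YD.image e
      have hdP : Disjoint YD (YD.image e) := by
        rw [Finset.disjoint_left]
        intro p hp hp'
        obtain ⟨q, hq, rfl⟩ := Finset.mem_image.1 hp'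
        have h1 := (hD _ (hYD _ hp)).2.2
        have h2 := (hD' _ (hYD _ hq)).2.2
        omega
      have hdRP : Disjoint YR P := by
        rw [Finset.disjoint_left]
        intro p hp hp'
        refine (hR p (hYR p hp)).2.1 ?_
        rcases Finset.mem_union.1 hp' with h | h
        · exact (hD p (hYD p h)).2.1
        · obtain ⟨q, hq, rfl⟩ := Finset.mem_image.1 h
          exact (hD' q (hYD q hq)).2.1
      have hSU : YR ∪ P ⊆ U := by
        intro i hi
        rcases Finset.mem_union.1 hi with hi | hi
        · exact (hR i (hYR i hi)).1
        rcases Finset.mem_union.1 hi with hi | hi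
        · exact (hD i (hYD i hi)).1
        · obtain ⟨q, hq, rfl⟩ := Finset.mem_image.1 hi
          exact (hD' q (hYD q hq)).1
      have hs0 : ∑ i ∈ YR ∪ P, ε i * reflInd (x i) = 0 := by
        rw [Finset.sum_union hdRP, Finset.sum_union hdP, Finset.sum_image heYD,
          ← Finset.sum_add_distrib]
        rw [Finset.sum_eq_zero, Finset.sum_eq_zero, add_zero]
        · intro p hp
          obtain ⟨-, a1, a2⟩ := hD p (hYD p hp)
          obtain ⟨-, a3, a4⟩ := hD' p (hYD p hp)
          simp [a1, a2, a3, a4]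
        · intro p hp
          rw [(reflInd_eq_zero_or_one (x p)).resolve_right (hR p (hYR p hp)).2.1, mul_zero]
      have hs1 : ∑ i ∈ YR ∪ P, (ε i : ZMod n) * dihIdx (x i) = 0 := by
        rw [← hY0, hYeq, Finset.sum_union hYRD, Finset.sum_union hdRP, Finset.sum_union hdP,
          Finset.sum_image heYD, ← Finset.sum_add_distrib]
        congr 1
        · exact Finset.sum_congr rfl fun i hi => (hwR i (hYR i hi)).symm
        · refine Finset.sum_congr rfl fun p hp => ?_
          rw [hwD p (hYD p hp), (hD p (hYD p hp)).2.2, (hD' p (hYD p hp)).2.2]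
          push_cast
          ring
      have hi₀' : i₀ ∈ U \ (YR ∪ P) := by
        refine Finset.mem_sdiff.2 ⟨hi₀, fun hh => ?_⟩
        rcases Finset.mem_union.1 hh with hi | hi
        · exact (hR _ (hYR _ hi)).2.1 hi₀r
        rcases Finset.mem_union.1 hi with hi | hi
        · exact hi₀D (hYD _ hi)
        · obtain ⟨q, hq, hq'⟩ := Finset.mem_image.1 hi
          exact hi₀e q (hYD q hq) hq'
      have hc0 := Finset.sum_sdiff (f := fun i => ε i * reflInd (x i)) hSU
      rw [hs0, h0, add_zero] at hc0
      have hc1 := Finset.sum_sdiff (f := fun i => (ε i : ZMod n) * dihIdx (x i)) hSU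
      rw [hs1, h1, add_zero] at hc1
      have hpc := isProductOne_of_sign x ε hε _ hc0 hc1 ⟨i₀, hi₀', hi₀r⟩
      have hps : IsProductOne ((YR ∪ P).val.map x) := by
        rcases YD.eq_empty_or_nonempty with hYD0 | ⟨p, hp⟩
        · have hP : P = ∅ := by simp [P, hYD0]
          rw [hP, Finset.union_empty] at hs1 ⊢
          rw [isProductOne_rotations_iff x _ fun i hi => (hR i (hYR i hi)).2.1]
          have : ∑ i ∈ YR, (ε i : ZMod n) * dihIdx (x i) =
              (τ : ZMod n) * ∑ i ∈ YR, dihIdx (x i) := by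
            rw [Finset.mul_sum]
            exact Finset.sum_congr rfl fun i hi => by rw [(hR i (hYR i hi)).2.2.2]
          rw [this] at hs1
          rcases hτ with rfl | rfl <;> simpa using hs1
        · exact isProductOne_of_sign x ε hε _ hs0 hs1 ⟨p, by simp [P, hp], (hD p (hYD p hp)).2.1⟩
      rcases hU.subset_trivial hSU hps hpc with h | h
      · have : Y ⊆ YR ∪ P := by
          rw [hYeq]
          exact Finset.union_subset_union subset_rfl Finset.subset_union_left
        rw [h] at this
        exact hne.ne_empty (Finset.subset_empty.1 this)
      · rw [h] at hi₀'
        simp at hi₀')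
  rw [Finset.card_union_of_disjoint hRDZ] at this
  simpa using this

/-- An atom with a reflection has at most `n` terms in a proper dihedral subgroup. -/
theorem card_class_le [NeZero n] (x : ι → DihedralGroup n) (U : Finset ι)
    (hU : IsAtomSeq (U.val.map x)) (hr : ∃ i ∈ U, reflInd (x i) = 1)
    (H : AddSubgroup (ZMod n)) (hH : 2 ≤ H.index) (c : ZMod n) (V : Finset ι) (hVU : V ⊆ U)
    (hV0 : ∀ i ∈ V, reflInd (x i) ≠ 1 → dihIdx (x i) ∈ H)
    (hV1 : ∀ i ∈ V, reflInd (x i) = 1 → dihIdx (x i) - c ∈ H) : V.card ≤ n := by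
  classical
  obtain ⟨ε, hε, h0, h1⟩ := exists_sign_of_isProductOne x U hU.2.1
  let Cl : (ι → ℤ) → ℤ → Finset ι := fun ε τ => V.filter fun i => reflInd (x i) = 1 ∧ ε i = τ
  wlog hle : (Cl ε (-1)).card ≤ (Cl ε 1).card generalizing ε
  · refine this (fun i => -ε i) (fun i => ?_) ?_ ?_ ?_
    · rcases hε i with h | h <;> simp [h]
    · simpa using h0
    · simpa using h1
    · have e1 : Cl (fun i => -ε i) (-1) = Cl ε 1 := by simp [Cl]
      have e2 : Cl (fun i => -ε i) 1 = Cl ε (-1) := by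
        simp only [Cl]
        congr 1
        ext i
        rw [neg_eq_iff_eq_neg]
      rw [e1, e2]
      omega
  set Cp := Cl ε 1 with hCp
  set Cm := Cl ε (-1) with hCm
  let Rt : ℤ → Finset ι := fun τ => V.filter fun i => reflInd (x i) ≠ 1 ∧ ε i = τ
  have hRt : ∀ τ, ∀ i ∈ Rt τ, i ∈ U ∧ reflInd (x i) ≠ 1 ∧ dihIdx (x i) ∈ H ∧ ε i = τ := by
    intro τ i hi
    obtain ⟨a, b, d⟩ := Finset.mem_filter.1 hi
    exact ⟨hVU a, b, hV0 i a b, d⟩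
  have hcardV : V.card = (Rt 1).card + (Rt (-1)).card + (Cp.card + Cm.card) := by
    have a1 := Finset.card_filter_add_card_filter_not (s := V) fun i => reflInd (x i) = 1
    have a2 := Finset.card_filter_add_card_filter_not
      (s := V.filter fun i => reflInd (x i) = 1) fun i => ε i = 1
    have a3 := Finset.card_filter_add_card_filter_not
      (s := V.filter fun i => ¬ reflInd (x i) = 1) fun i => ε i = 1
    rw [Finset.filter_filter, Finset.filter_filter] at a2 a3
    have hneg : ∀ i, (¬ ε i = 1) ↔ ε i = -1 := fun i => by rcases hε i with h | h <;> simp [h]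
    simp only [hneg] at a2 a3
    have b1 : Cp = V.filter fun i => reflInd (x i) = 1 ∧ ε i = 1 := rfl
    have b2 : Cm = V.filter fun i => reflInd (x i) = 1 ∧ ε i = -1 := rfl
    have b3 : Rt 1 = V.filter fun i => ¬ reflInd (x i) = 1 ∧ ε i = 1 := rfl
    have b4 : Rt (-1) = V.filter fun i => ¬ reflInd (x i) = 1 ∧ ε i = -1 := rfl
    rw [b1, b2, b3, b4]
    omega
  have hidx : H.index * Nat.card H = n := by rw [H.index_mul_card, Nat.card_zmod]
  set Rm := U.filter fun i => reflInd (x i) = 1 ∧ ε i = -1 with hRm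
  have hCmRm : Cm ⊆ Rm := by
    intro i hi
    obtain ⟨a, b⟩ := Finset.mem_filter.1 hi
    exact Finset.mem_filter.2 ⟨hVU a, b⟩
  have hCpRm : Cp.card ≤ Rm.card := by
    have : Cp ⊆ U.filter fun i => reflInd (x i) = 1 ∧ ε i = 1 := by
      intro i hi
      obtain ⟨a, b⟩ := Finset.mem_filter.1 hi
      exact Finset.mem_filter.2 ⟨hVU a, b⟩
    refine (Finset.card_le_card this).trans ?_
    have hsum : ∑ i ∈ U, ε i * reflInd (x i) =
        ((U.filter fun i => reflInd (x i) = 1 ∧ ε i = 1).card : ℤ) - Rm.card := by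
      rw [Finset.card_filter, hRm, Finset.card_filter]
      push_cast
      rw [← Finset.sum_sub_distrib]
      refine Finset.sum_congr rfl fun i _ => ?_
      rcases hε i with h | h <;> rcases reflInd_eq_zero_or_one (x i) with h' | h' <;>
        simp [h, h']
    omega
  obtain ⟨R', hCmR', hR'Rm, hR'c⟩ := Finset.exists_subsuperset_card_eq hCmRm hle hCpRm
  obtain ⟨e, heinj, heimg⟩ := exists_bijection_of_card_eq hR'c.symm
  have heR' : ∀ p ∈ Cp, e p ∈ Rm := fun p hp =>
    hR'Rm (by rw [← heimg]; exact Finset.mem_image_of_mem e hp)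
  have hpre : (Cp.filter fun p => e p ∈ Cm).card = Cm.card := by
    have : (Cp.filter fun p => e p ∈ Cm).image e = Cm := by
      ext j
      simp only [Finset.mem_image, Finset.mem_filter]
      constructor
      · rintro ⟨p, ⟨-, hp⟩, rfl⟩
        exact hp
      · intro hj
        have := hCmR' hj
        rw [← heimg] at this
        obtain ⟨p, hp, rfl⟩ := Finset.mem_image.1 this
        exact ⟨p, ⟨hp, hj⟩, rfl⟩
    rw [← this, Finset.card_image_of_injOn (heinj.mono (Finset.filter_subset _ _))]
    rw [this]
  have bound : ∀ D ⊆ Cp, ∀ i₀ ∈ U, reflInd (x i₀) = 1 → i₀ ∉ D → (∀ p ∈ D, e p ≠ i₀) →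
      ∀ τ : ℤ, (τ = 1 ∨ τ = -1) →
      H.index * ((Rt τ).card + (D.filter fun p => e p ∈ Cm).card) +
        (D.filter fun p => e p ∉ Cm).card + 1 ≤ n := by
    intro D hD i₀ hi₀ hi₀r hi₀D hi₀e τ hτ
    have hun := Finset.filter_union_filter_not_eq (fun p => e p ∈ Cm) D
    refine atom_sign_bound x U hU ε hε h0 h1 H (Rt τ) _ _ τ hτ (hRt τ) e
      (Finset.disjoint_filter_filter_not _ _ _) ?_ ?_ ?_ ?_ i₀ hi₀ hi₀r ?_ ?_
    · rw [hun]
      exact heinj.mono hD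
    · rw [hun]
      intro p hp
      obtain ⟨a, b⟩ := Finset.mem_filter.1 (hD hp)
      exact ⟨hVU a, b⟩
    · rw [hun]
      intro p hp
      exact Finset.mem_filter.1 (heR' p (hD hp))
    · intro p hp
      obtain ⟨hpD, hpe⟩ := Finset.mem_filter.1 hp
      obtain ⟨a, b, -⟩ := Finset.mem_filter.1 (hD hpD)
      obtain ⟨a', b', -⟩ := Finset.mem_filter.1 hpe
      simpa using H.sub_mem (hV1 p a b) (hV1 _ a' b')
    · rwa [hun]
    · rwa [hun]
  rcases Cp.eq_empty_or_nonempty with hCp0 | hCpne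
  · obtain ⟨i₀, hi₀, hi₀r⟩ := hr
    have hb := bound ∅ (by simp) i₀ hi₀ hi₀r (by simp) (by simp)
    have hb1 := hb 1 (by simp)
    have hb2 := hb (-1) (by simp)
    have c0 : Cp.card = 0 := by rw [hCp0]; rfl
    simp only [Finset.filter_empty, Finset.card_empty, add_zero] at hb1 hb2
    nlinarith
  · have drop : ∀ a₀ ∈ Cp, ∀ τ : ℤ, (τ = 1 ∨ τ = -1) →
        H.index * ((Rt τ).card + ((Cp.erase a₀).filter fun p => e p ∈ Cm).card) +
        ((Cp.erase a₀).filter fun p => e p ∉ Cm).card + 1 ≤ n := by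
      intro a₀ ha₀
      obtain ⟨a, b, d⟩ := Finset.mem_filter.1 ha₀
      refine bound (Cp.erase a₀) (Finset.erase_subset _ _) a₀ (hVU a) b (by simp) ?_
      intro p hp he
      have := (Finset.mem_filter.1 (heR' p (Finset.mem_of_mem_erase hp))).2.2
      rw [he] at this
      omega
    rcases hle.lt_or_eq with hlt | heq
    · obtain ⟨a₀, ha₀, ha₀e⟩ : ∃ a₀ ∈ Cp, e a₀ ∉ Cm := by
        by_contra! hall
        rw [Finset.filter_true_of_mem hall] at hpre
        omega
      have h1 := drop a₀ ha₀ 1 (by simp)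
      have h2 := drop a₀ ha₀ (-1) (by simp)
      have hz : ((Cp.erase a₀).filter fun p => e p ∈ Cm).card = Cm.card := by
        rw [← hpre, Finset.filter_erase, Finset.erase_eq_of_notMem (by simp [ha₀e])]
      have hw := Finset.card_filter_add_card_filter_not (s := Cp.erase a₀) fun p => e p ∈ Cm
      rw [Finset.card_erase_of_mem ha₀, hz] at hw
      rw [hz] at h1 h2
      have k1 := Nat.mul_le_mul_right ((Rt 1).card + Cm.card) hH
      have k2 := Nat.mul_le_mul_right ((Rt (-1)).card + Cm.card) hH
      omega
    · obtain ⟨a₀, ha₀⟩ := hCpne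
      have h1 := drop a₀ ha₀ 1 (by simp)
      have h2 := drop a₀ ha₀ (-1) (by simp)
      have hz : (Cp.filter fun p => e p ∈ Cm) = Cp :=
        Finset.eq_of_subset_of_card_le (Finset.filter_subset _ _) (by omega)
      have hz' : ((Cp.erase a₀).filter fun p => e p ∈ Cm).card = Cp.card - 1 := by
        rw [Finset.filter_erase, hz, Finset.card_erase_of_mem ha₀]
      have hpos := Finset.card_pos.2 ⟨a₀, ha₀⟩
      rw [hz'] at h1 h2
      have key : ∀ y : ℕ, H.index * (y + (Cp.card - 1)) < n → y + Cp.card ≤ Nat.card H := by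
        intro y hy
        have := Nat.lt_of_mul_lt_mul_left (hy.trans_eq hidx.symm)
        omega
      have k1 := key _ (by omega : H.index * ((Rt 1).card + (Cp.card - 1)) < n)
      have k2 := key _ (by omega : H.index * ((Rt (-1)).card + (Cp.card - 1)) < n)
      nlinarith

end AtomClass

/-! ### Balanced signings of blocks -/

section Signing

variable {n : ℕ} {ι σ : Type*}

/-- `ε` is a sign function for which the signed sums of `ρ` and `v` over `s` vanish. -/
def SignedZero (ρ : ι → ℤ) (v : ι → ZMod n) (ε : ι → ℤ) (s : Finset ι) : Prop :=
  (∀ i, ε i = 1 ∨ ε i = -1) ∧ ∑ i ∈ s, ε i * ρ i = 0 ∧ ∑ i ∈ s, (ε i : ZMod n) * v i = 0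

/-- The signed number of reflections in the block `β`. -/
def blockDefect [DecidableEq σ] (C : Finset ι) (ρ : ι → ℤ) (blk : ι → Option σ) (ε : ι → ℤ)
    (β : Option σ) : ℤ :=
  ∑ i ∈ C, ε i * (if blk i = β then ρ i else 0)

theorem sum_flip [DecidableEq ι] {R : Type*} [CommRing R] {C Z : Finset ι} (hZ : Z ⊆ C)
    (ε : ι → ℤ) (f : ι → R) :
    ∑ i ∈ C, ((if i ∈ Z then -ε i else ε i : ℤ) : R) * f i =
      ∑ i ∈ C, (ε i : R) * f i - 2 * ∑ i ∈ Z, (ε i : R) * f i := by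
  rw [← Finset.sum_sdiff hZ, ← Finset.sum_sdiff hZ (f := fun i => (ε i : R) * f i)]
  have h1 : ∑ i ∈ C \ Z, ((if i ∈ Z then -ε i else ε i : ℤ) : R) * f i =
      ∑ i ∈ C \ Z, (ε i : R) * f i :=
    Finset.sum_congr rfl fun i hi => by rw [if_neg (Finset.mem_sdiff.1 hi).2]
  have h2 : ∑ i ∈ Z, ((if i ∈ Z then -ε i else ε i : ℤ) : R) * f i =
      -∑ i ∈ Z, (ε i : R) * f i := by
    rw [← Finset.sum_neg_distrib]
    exact Finset.sum_congr rfl fun i hi => by rw [if_pos hi]; push_cast; ring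
  rw [h1, h2]
  ring

theorem sum_flip_int [DecidableEq ι] {C Z : Finset ι} (hZ : Z ⊆ C) (ε f : ι → ℤ) :
    ∑ i ∈ C, (if i ∈ Z then -ε i else ε i) * f i =
      ∑ i ∈ C, ε i * f i - 2 * ∑ i ∈ Z, ε i * f i := by
  simpa using sum_flip hZ ε f

theorem sum_removed [DecidableEq σ] {R : Type*} [CommRing R] (C : Finset ι) (ε f : ι → R)
    (blk : ι → Option σ) (I : Finset σ) [∀ i, Decidable (∀ β ∈ I, blk i ≠ some β)] :
    ∑ i ∈ C, ε i * (if ∀ β ∈ I, blk i ≠ some β then f i else 0) =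
      ∑ i ∈ C, ε i * f i - ∑ β ∈ I, ∑ i ∈ C, ε i * (if blk i = some β then f i else 0) := by
  rw [Finset.sum_comm, ← Finset.sum_sub_distrib]
  refine Finset.sum_congr rfl fun i _ => ?_
  rw [← Finset.mul_sum, ← mul_sub]
  congr 1
  by_cases h : ∀ β ∈ I, blk i ≠ some β
  · rw [if_pos h, Finset.sum_eq_zero fun β hβ => if_neg (h β hβ), sub_zero]
  · rw [if_neg h]
    push Not at h
    obtain ⟨β, hβ, hb⟩ := h
    rw [Finset.sum_eq_single β, if_pos hb, sub_self]
    · intro γ _ hγ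
      refine if_neg fun hh => hγ ?_
      rw [hb] at hh
      exact (Option.some.inj hh).symm
    · exact fun hh => absurd hβ hh

/-- With respect to a zero signing of minimal total defect, no nontrivial combination of base flips,
exchanges of plus- and minus-reflections, and removals of balanced blocks has sum zero. -/
theorem exchange_zeroSumFree [DecidableEq ι] [DecidableEq σ] [Fintype σ]
    (C : Finset ι) (ρ : ι → ℤ) (v : ι → ZMod n) (blk : ι → Option σ) (ε : ι → ℤ)
    (hz : SignedZero ρ v ε C)
    (hopt : ∀ ε', SignedZero ρ v ε' C → ∑ β, (blockDefect C ρ blk ε β).natAbs ≤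
      ∑ β, (blockDefect C ρ blk ε' β).natAbs)
    (hmin : ∀ I : Finset σ, I.Nonempty → ∀ ε',
      ¬ SignedZero ρ v ε' (C.filter fun i => ∀ β ∈ I, blk i ≠ some β))
    (N : ℕ) (hN : Even N) (a b : ℕ → ι)
    (ha : ∀ t < N, a t ∈ C ∧ ρ (a t) = 1 ∧ ε (a t) = 1)
    (hb : ∀ t < N, b t ∈ C ∧ ρ (b t) = 1 ∧ ε (b t) = -1)
    (hainj : Set.InjOn a (Finset.range N)) (hbinj : Set.InjOn b (Finset.range N))
    (hapair : ∀ t, 2 * t + 1 < N → blk (a (2 * t)) = blk (a (2 * t + 1)))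
    (hbpair : ∀ t, 2 * t + 1 < N → blk (b (2 * t)) = blk (b (2 * t + 1)))
    (hacard : ∀ β, ((Finset.range N).filter fun t => blk (a t) = β).card =
      (blockDefect C ρ blk ε β).toNat)
    (hbcard : ∀ β, ((Finset.range N).filter fun t => blk (b t) = β).card =
      (-blockDefect C ρ blk ε β).toNat)
    (Z₀ : Finset ι) (hZ₀C : Z₀ ⊆ C) (hZ₀blk : ∀ i ∈ Z₀, blk i = none)
    (hZ₀sum : ∑ i ∈ Z₀, ε i * ρ i = 0)
    (hZ₀a : ∀ t < N, a t ∉ Z₀) (hZ₀b : ∀ t < N, b t ∉ Z₀)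
    (X : Finset ℕ) (hX : X ⊆ Finset.range (N - 1)) (I : Finset σ)
    (hI : ∀ β ∈ I, blockDefect C ρ blk ε (some β) = 0)
    (hsum : 2 * ∑ i ∈ Z₀, (ε i : ZMod n) * v i + (∑ t ∈ X, 2 * (v (a t) - v (b (t + 1))) +
      ∑ β ∈ I, ∑ i ∈ C, (ε i : ZMod n) * (if blk i = some β then v i else 0)) = 0) :
    X = ∅ ∧ I = ∅ := by
  set d := blockDefect C ρ blk ε with hd
  have hXN : ∀ t ∈ X, t < N ∧ t + 1 < N := by
    intro t ht
    have := Finset.mem_range.1 (hX ht)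
    omega
  have hainjX : Set.InjOn a X := hainj.mono fun t ht => by simpa using (hXN t ht).1
  have hbinjX : Set.InjOn (fun t => b (t + 1)) X := by
    intro s hs t ht h
    have := hbinj (by simpa using (hXN s hs).2) (by simpa using (hXN t ht).2) h
    omega
  set Z₁ := X.image a
  set Z₂ := X.image fun t => b (t + 1)
  have hd12 : Disjoint Z₁ Z₂ := by
    rw [Finset.disjoint_left]
    intro i hi hi'
    obtain ⟨s, hs, rfl⟩ := Finset.mem_image.1 hi
    obtain ⟨t, ht, h⟩ := Finset.mem_image.1 hi'
    have h1 := (ha s (hXN s hs).1).2.2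
    have h2 := (hb _ (hXN t ht).2).2.2
    rw [h] at h2
    omega
  have hd0 : Disjoint Z₀ (Z₁ ∪ Z₂) := by
    rw [Finset.disjoint_left]
    intro i hi hi'
    rcases Finset.mem_union.1 hi' with h | h
    · obtain ⟨s, hs, rfl⟩ := Finset.mem_image.1 h
      exact hZ₀a s (hXN s hs).1 hi
    · obtain ⟨s, hs, rfl⟩ := Finset.mem_image.1 h
      exact hZ₀b _ (hXN s hs).2 hi
  set Z := Z₀ ∪ (Z₁ ∪ Z₂) with hZ
  have hZC : Z ⊆ C := by
    refine Finset.union_subset hZ₀C (Finset.union_subset ?_ ?_)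
    · intro i hi
      obtain ⟨s, hs, rfl⟩ := Finset.mem_image.1 hi
      exact (ha s (hXN s hs).1).1
    · intro i hi
      obtain ⟨s, hs, rfl⟩ := Finset.mem_image.1 hi
      exact (hb _ (hXN s hs).2).1
  have sumZ : ∀ {R : Type} [CommRing R] (f : ι → R), ∑ i ∈ Z, (ε i : R) * f i =
      ∑ i ∈ Z₀, (ε i : R) * f i + ∑ t ∈ X, (f (a t) - f (b (t + 1))) := by
    intro R _ f
    rw [hZ, Finset.sum_union hd0, Finset.sum_union hd12, Finset.sum_image hainjX,
      Finset.sum_image hbinjX, ← Finset.sum_add_distrib]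
    congr 1
    refine Finset.sum_congr rfl fun t ht => ?_
    rw [(ha t (hXN t ht).1).2.2, (hb _ (hXN t ht).2).2.2]
    push_cast
    ring
  let ε' : ι → ℤ := fun i => if i ∈ Z then -ε i else ε i
  have hε' : ∀ i, ε' i = 1 ∨ ε' i = -1 := by
    intro i
    simp only [ε']
    rcases hz.1 i with h | h <;> split_ifs <;> simp [h]
  have hZρ : ∑ i ∈ Z, ε i * ρ i = 0 := by
    have := sumZ ρ
    simp only [Int.cast_id] at this
    rw [this, hZ₀sum, zero_add]
    refine Finset.sum_eq_zero fun t ht => ?_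
    rw [(ha t (hXN t ht).1).2.1, (hb _ (hXN t ht).2).2.1, sub_self]
  have hI0 : I = ∅ := by
    by_contra hne
    refine hmin I (Finset.nonempty_iff_ne_empty.2 hne) ε' ⟨hε', ?_, ?_⟩
    all_goals
      have hkeep : ∀ i ∈ Z, ∀ β ∈ I, blk i ≠ some β := by
        intro i hi β hβ hh
        have hdβ : d (some β) = 0 := hI β hβ
        rcases Finset.mem_union.1 hi with hi | hi
        · rw [hZ₀blk i hi] at hh
          simp at hh
        rcases Finset.mem_union.1 hi with hi | hi
        · obtain ⟨t, ht, rfl⟩ := Finset.mem_image.1 hi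
          have := hacard (some β)
          rw [hdβ, Int.toNat_zero, Finset.card_eq_zero, Finset.filter_eq_empty_iff] at this
          exact this (by simpa using (hXN t ht).1) hh
        · obtain ⟨t, ht, rfl⟩ := Finset.mem_image.1 hi
          have := hbcard (some β)
          rw [hdβ, neg_zero, Int.toNat_zero, Finset.card_eq_zero,
            Finset.filter_eq_empty_iff] at this
          exact this (by simpa using (hXN t ht).2) hh
    · rw [Finset.sum_filter]
      simp only [← mul_ite_zero]
      rw [sum_flip_int hZC, sum_removed C ε ρ, hz.2.1]
      rw [Finset.sum_congr (s₁ := Z) rfl fun i hi => by rw [if_pos (hkeep i hi)], hZρ]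
      have hI' : ∑ β ∈ I, ∑ i ∈ C, ε i * (if blk i = some β then ρ i else 0) = 0 :=
        Finset.sum_eq_zero hI
      rw [hI']
      simp
    · rw [Finset.sum_filter]
      simp only [← mul_ite_zero]
      rw [sum_flip hZC, sum_removed C (fun i => (ε i : ZMod n)) v, hz.2.2]
      rw [Finset.sum_congr (s₁ := Z) rfl fun i hi => by rw [if_pos (hkeep i hi)], sumZ]
      rw [← Finset.mul_sum] at hsum
      linear_combination -hsum
  refine ⟨?_, hI0⟩
  subst hI0
  by_contra hXne
  have hXne := Finset.nonempty_iff_ne_empty.2 hXne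
  have hz' : SignedZero ρ v ε' C := by
    refine ⟨hε', ?_, ?_⟩
    · rw [sum_flip_int hZC, hz.2.1, hZρ]
      simp
    · rw [sum_flip hZC, hz.2.2, sumZ]
      rw [← Finset.mul_sum] at hsum
      simp only [Finset.sum_empty] at hsum
      linear_combination -hsum
  let px : Option σ → ℕ := fun β => (X.filter fun t => blk (a t) = β).card
  let py : Option σ → ℕ := fun β => (X.filter fun t => blk (b (t + 1)) = β).card
  have hd' : ∀ β, blockDefect C ρ blk ε' β = d β - 2 * px β + 2 * py β := by
    intro β
    rw [blockDefect, sum_flip_int hZC]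
    have := sumZ fun i => if blk i = β then ρ i else 0
    simp only [Int.cast_id] at this
    rw [this]
    have e0 : ∑ i ∈ Z₀, ε i * (if blk i = β then ρ i else 0) = 0 := by
      by_cases hβ : β = none
      · rw [← hZ₀sum]
        exact Finset.sum_congr rfl fun i hi => by rw [if_pos (by rw [hZ₀blk i hi, hβ])]
      · refine Finset.sum_eq_zero fun i hi => ?_
        rw [if_neg (by rw [hZ₀blk i hi]; exact fun h => hβ h.symm), mul_zero]
    have e1 : ∑ t ∈ X, ((if blk (a t) = β then ρ (a t) else 0) -
        if blk (b (t + 1)) = β then ρ (b (t + 1)) else 0) = px β - py β := by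
      rw [Finset.sum_sub_distrib]
      congr 1
      · simp only [px, Finset.card_filter]
        push_cast
        exact Finset.sum_congr rfl fun t ht => by rw [(ha t (hXN t ht).1).2.1]
      · simp only [py, Finset.card_filter]
        push_cast
        exact Finset.sum_congr rfl fun t ht => by rw [(hb _ (hXN t ht).2).2.1]
    rw [e0, e1, hd, blockDefect]
    ring
  have hpsub : ∀ β, (X.filter fun t => blk (a t) = β) ⊆
      (Finset.range N).filter fun t => blk (a t) = β := fun β t ht => by
    rw [Finset.mem_filter] at ht ⊢
    exact ⟨by simpa using (hXN t ht.1).1, ht.2⟩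
  have hqsub : ∀ β, (X.filter fun t => blk (b (t + 1)) = β).image (· + 1) ⊆
      (Finset.range N).filter fun t => blk (b t) = β := fun β t ht => by
    obtain ⟨s, hs, rfl⟩ := Finset.mem_image.1 ht
    rw [Finset.mem_filter] at hs ⊢
    exact ⟨by simpa using (hXN s hs.1).2, hs.2⟩
  have hqcard : ∀ β, ((X.filter fun t => blk (b (t + 1)) = β).image (· + 1)).card = py β :=
    fun β => Finset.card_image_of_injective _ (add_left_injective 1)
  have hple : ∀ β, px β ≤ (d β).toNat := fun β => by
    rw [← hacard]
    exact Finset.card_le_card (hpsub β)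
  have hqle : ∀ β, py β ≤ (-d β).toNat := fun β => by
    rw [← hbcard, ← hqcard]
    exact Finset.card_le_card (hqsub β)
  have hle : ∀ β, (blockDefect C ρ blk ε' β).natAbs ≤ (d β).natAbs := by
    intro β
    rw [hd']
    have := hple β
    have := hqle β
    omega
  have hlt : ∃ β, (blockDefect C ρ blk ε' β).natAbs < (d β).natAbs := by
    have htX := Finset.max'_mem X hXne
    set t := X.max' hXne
    have hsucc : t + 1 ∉ X := fun h => by
      have := Finset.le_max' X _ h
      omega
    have ht := hXN t htX
    rcases Nat.even_or_odd' t with ⟨k, hk | hk⟩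
    · refine ⟨blk (a t), ?_⟩
      have h1 : px (blk (a t)) < (d (blk (a t))).toNat := by
        rw [← hacard]
        refine Finset.card_lt_card ((Finset.ssubset_iff_of_subset (hpsub _)).2 ⟨t + 1, ?_, ?_⟩)
        · rw [Finset.mem_filter]
          refine ⟨by simpa using ht.2, ?_⟩
          rw [hk]
          exact (hapair k (by omega)).symm
        · simp [hsucc]
      have h2 : 0 < px (blk (a t)) := Finset.card_pos.2 ⟨t, by simp [htX]⟩
      have := hqle (blk (a t))
      rw [hd']
      omega
    · refine ⟨blk (b (t + 1)), ?_⟩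
      have ht2 : t + 2 < N := by
        obtain ⟨m, hm⟩ := hN
        omega
      have h1 : py (blk (b (t + 1))) < (-d (blk (b (t + 1)))).toNat := by
        rw [← hbcard, ← hqcard]
        refine Finset.card_lt_card ((Finset.ssubset_iff_of_subset (hqsub _)).2 ⟨t + 2, ?_, ?_⟩)
        · rw [Finset.mem_filter]
          refine ⟨by simpa using ht2, ?_⟩
          have := hbpair (k + 1) (by omega)
          rw [show t + 1 = 2 * (k + 1) by omega, show t + 2 = 2 * (k + 1) + 1 by omega]
          exact this.symm
        · intro h
          obtain ⟨s, hs, hst⟩ := Finset.mem_image.1 h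
          have : s = t + 1 := by omega
          subst this
          exact hsucc (Finset.mem_filter.1 hs).1
      have h2 : 0 < py (blk (b (t + 1))) := Finset.card_pos.2 ⟨t, by simp [htX]⟩
      have := hple (blk (b (t + 1)))
      rw [hd']
      omega
  obtain ⟨β, hβ⟩ := hlt
  have := Finset.sum_lt_sum (fun β _ => hle β) ⟨β, Finset.mem_univ _, hβ⟩
  have := hopt ε' hz'
  omega

end Signing

/-! ### Enumerating blocks -/

section Enumeration

variable {ι τ : Type*} [DecidableEq ι] [DecidableEq τ]

theorem exists_subset_fiber_card (S : Finset ι) (blk : ι → τ) (k : τ → ℕ)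
    (h : ∀ β, k β ≤ (S.filter fun i => blk i = β).card) :
    ∃ A ⊆ S, ∀ β, (A.filter fun i => blk i = β).card = k β := by
  choose T hT hcard using fun β => Finset.exists_subset_card_eq (h β)
  refine ⟨S.filter fun i => i ∈ T (blk i), Finset.filter_subset _ _, fun β => ?_⟩
  rw [← hcard β]
  congr 1
  ext i
  simp only [Finset.mem_filter]
  constructor
  · rintro ⟨⟨_, h1⟩, rfl⟩
    exact h1
  · intro hi
    obtain ⟨h1, h2⟩ := Finset.mem_filter.1 (hT β hi)
    exact ⟨⟨h1, by rwa [h2]⟩, h2⟩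

theorem exists_paired_enumeration [Nonempty ι] (blk : ι → τ) (A : Finset ι)
    (h : ∀ β, Even (A.filter fun i => blk i = β).card) :
    Even A.card ∧ ∃ a : ℕ → ι, Set.InjOn a (Finset.range A.card) ∧
      (Finset.range A.card).image a = A ∧
      ∀ t, 2 * t + 1 < A.card → blk (a (2 * t)) = blk (a (2 * t + 1)) := by
  induction A using Finset.strongInduction with
  | H A ih =>
    rcases A.eq_empty_or_nonempty with rfl | ⟨i, hi⟩
    · exact ⟨by simp, fun _ => Classical.arbitrary ι, by simp, by simp, by simp⟩
    have hfi : i ∈ A.filter fun j => blk j = blk i := Finset.mem_filter.2 ⟨hi, rfl⟩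
    obtain ⟨j, hj, hji⟩ : ∃ j ∈ A.filter (fun j => blk j = blk i), j ≠ i := by
      refine Finset.exists_mem_ne ?_ i
      have h1 := Finset.card_pos.2 ⟨i, hfi⟩
      obtain ⟨m, hm⟩ := h (blk i)
      omega
    obtain ⟨hjA, hjb⟩ := Finset.mem_filter.1 hj
    set A' := (A.erase i).erase j with hA'
    have hj' : j ∈ A.erase i := Finset.mem_erase.2 ⟨hji, hjA⟩
    have hcard : A.card = A'.card + 2 := by
      have h1 := Finset.card_erase_add_one hj'
      have h2 := Finset.card_erase_add_one hi
      rw [← hA'] at h1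
      omega
    have hss : A' ⊂ A := by
      refine (Finset.ssubset_iff_of_subset ((Finset.erase_subset _ _).trans
        (Finset.erase_subset _ _))).2 ⟨i, hi, by simp⟩
    have hA'even : ∀ β, Even (A'.filter fun i => blk i = β).card := by
      intro β
      by_cases hβ : blk i = β
      · have h1 : (A'.filter fun i => blk i = β) =
            ((A.filter fun i => blk i = β).erase i).erase j := by
          ext x
          simp only [hA', Finset.mem_filter, Finset.mem_erase]
          tauto
        have h2 := Finset.card_erase_add_one
          (show i ∈ A.filter fun i => blk i = β from Finset.mem_filter.2 ⟨hi, hβ⟩)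
        have h3 := Finset.card_erase_add_one
          (show j ∈ (A.filter fun i => blk i = β).erase i from
            Finset.mem_erase.2 ⟨hji, Finset.mem_filter.2 ⟨hjA, hjb.trans hβ⟩⟩)
        obtain ⟨m, hm⟩ := h β
        rw [h1]
        exact ⟨m - 1, by omega⟩
      · have h1 : (A'.filter fun i => blk i = β) = A.filter fun i => blk i = β := by
          ext x
          simp only [hA', Finset.mem_filter, Finset.mem_erase]
          constructor
          · tauto
          · rintro ⟨hx, hxβ⟩
            refine ⟨⟨?_, ?_, hx⟩, hxβ⟩
            · rintro rfl
              exact hβ (hjb.symm.trans hxβ)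
            · rintro rfl
              exact hβ hxβ
        rw [h1]
        exact h β
    obtain ⟨hev, a, hinj, him, hp⟩ := ih A' hss hA'even
    have haA' : ∀ t < A'.card, a t ∈ A' := fun t ht => by
      rw [← him]
      exact Finset.mem_image_of_mem _ (Finset.mem_range.2 ht)
    have hiA' : i ∉ A' := by simp [hA']
    have hjA' : j ∉ A' := by simp [hA']
    let a' : ℕ → ι := fun t => if t < A'.card then a t else if t = A'.card then i else j
    have e1 : ∀ t < A'.card, a' t = a t := fun t ht => if_pos ht
    have e2 : a' A'.card = i := by simp [a']
    have e3 : a' (A'.card + 1) = j := by simp [a']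
    refine ⟨by rw [hcard]; exact hev.add even_two, a', ?_, ?_, ?_⟩
    · intro s hs t ht hst
      simp only [Finset.coe_range, Set.mem_Iio, hcard] at hs ht
      rcases (by omega : s < A'.card ∨ s = A'.card ∨ s = A'.card + 1) with h1 | rfl | rfl <;>
        rcases (by omega : t < A'.card ∨ t = A'.card ∨ t = A'.card + 1) with h2 | rfl | rfl
      · rw [e1 s h1, e1 t h2] at hst
        exact hinj (by simpa using h1) (by simpa using h2) hst
      · rw [e1 s h1, e2] at hst
        exact absurd (hst ▸ haA' s h1) hiA'
      · rw [e1 s h1, e3] at hst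
        exact absurd (hst ▸ haA' s h1) hjA'
      · rw [e1 t h2, e2] at hst
        exact absurd (hst ▸ haA' t h2) hiA'
      · rfl
      · rw [e2, e3] at hst
        exact absurd hst.symm hji
      · rw [e1 t h2, e3] at hst
        exact absurd (hst ▸ haA' t h2) hjA'
      · rw [e2, e3] at hst
        exact absurd hst hji
      · rfl
    · rw [hcard, Finset.range_add_one, Finset.range_add_one, Finset.image_insert,
        Finset.image_insert, e2, e3,
        Finset.image_congr (g := a) fun t ht => e1 t (by simpa using ht), him, hA']
      rw [Finset.insert_comm, Finset.insert_erase hj', Finset.insert_erase hi]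
    · intro t ht
      obtain ⟨m, hm⟩ := hev
      by_cases h1 : 2 * t + 1 < A'.card
      · rw [e1 _ h1, e1 _ (by omega)]
        exact hp t h1
      · have h2 : 2 * t = A'.card := by omega
        rw [h2, e2, e3, hjb]

theorem card_filter_range_eq {A : Finset ι} {a : ℕ → ι} (blk : ι → τ)
    (hinj : Set.InjOn a (Finset.range A.card)) (him : (Finset.range A.card).image a = A) (β : τ) :
    ((Finset.range A.card).filter fun t => blk (a t) = β).card =
      (A.filter fun i => blk i = β).card := by
  conv_rhs => rw [← him]
  rw [Finset.filter_image, Finset.card_image_of_injOn]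
  exact hinj.mono fun t ht => by
    simpa using (Finset.mem_filter.1 ht).1

end Enumeration

/-! ### Packing rotations and reflection pairs -/

section Packing

variable {n : ℕ} {ι : Type*} [DecidableEq ι]

/-- A rotation, or a pair of reflections of opposite sign. -/
def IsFlipItem (ρ ε : ι → ℤ) (y : Finset ι) : Prop :=
  (∃ i, y = {i} ∧ ρ i = 0) ∨
    ∃ p m, y = {p, m} ∧ ρ p = 1 ∧ ρ m = 1 ∧ ε p = 1 ∧ ε m = -1

theorem sum_pair_of_sign {R : Type*} [CommRing R] {ε : ι → ℤ} {p m : ι} (hp : ε p = 1)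
    (hm : ε m = -1) (f : ι → R) : ∑ i ∈ {p, m}, (ε i : R) * f i = f p - f m := by
  have : p ≠ m := by
    rintro rfl
    omega
  rw [Finset.sum_pair this, hp, hm]
  push_cast
  ring

theorem IsFlipItem.sum_eq_zero {ρ ε : ι → ℤ} {y : Finset ι} (h : IsFlipItem ρ ε y) :
    ∑ i ∈ y, ε i * ρ i = 0 := by
  rcases h with ⟨i, rfl, hi⟩ | ⟨p, m, rfl, hp, hm, hεp, hεm⟩
  · simp [hi]
  · have := sum_pair_of_sign hεp hεm ρ
    simp only [Int.cast_id] at this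
    rw [this, hp, hm, sub_self]

theorem IsFlipItem.nonempty {ρ ε : ι → ℤ} {y : Finset ι} (h : IsFlipItem ρ ε y) : y.Nonempty := by
  rcases h with ⟨i, rfl, hi⟩ | ⟨p, m, rfl, hp, hm, hεp, hεm⟩
  · exact Finset.singleton_nonempty i
  · exact Finset.insert_nonempty _ _

theorem IsFlipItem.card_le_two {ρ ε : ι → ℤ} {y : Finset ι} (h : IsFlipItem ρ ε y) :
    y.card ≤ 2 := by
  rcases h with ⟨i, rfl, hi⟩ | ⟨p, m, rfl, hp, hm, hεp, hεm⟩
  · simp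
  · exact Finset.card_le_two

theorem IsFlipItem.card_filter_le_one {ρ ε : ι → ℤ} {y : Finset ι} (h : IsFlipItem ρ ε y) :
    (y.filter fun i => ρ i = 0).card ≤ 1 := by
  rcases h with ⟨i, rfl, hi⟩ | ⟨p, m, rfl, hp, hm, hεp, hεm⟩
  · exact (Finset.card_le_card (Finset.filter_subset _ _)).trans (by simp)
  · simp [Finset.filter_insert, Finset.filter_singleton, hp, hm]

theorem mem_of_two_mul_mem (hodd : Odd n) {H : AddSubgroup (ZMod n)} {z : ZMod n}
    (h : 2 * z ∈ H) : z ∈ H := by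
  obtain ⟨k, hk⟩ := hodd
  have h1 := H.nsmul_mem h (k + 1)
  have h0 : ((2 * k + 1 : ℕ) : ZMod n) = 0 := by
    rw [← hk, ZMod.natCast_self]
  have h2 : (k + 1) • (2 * z) = z := by
    rw [nsmul_eq_mul]
    push_cast at h0 ⊢
    linear_combination z * h0
  rwa [h2] at h1

theorem exists_packing [NeZero n] (hodd : Odd n) {κ : Type*} (B : Finset ι) (ρ ε : ι → ℤ)
    (v : ι → ZMod n) (hρ : ∀ i, ρ i = 0 ∨ ρ i = 1) (hε : ∀ i, ε i = 1 ∨ ε i = -1)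
    (hB : ∑ i ∈ B, ε i * ρ i = 0) (S : Finset κ) (h : κ → ZMod n)
    (hfree : ∀ Z ⊆ B, ∑ i ∈ Z, ε i * ρ i = 0 → ∀ X ⊆ S,
      2 * ∑ i ∈ Z, (ε i : ZMod n) * v i + ∑ k ∈ X, h k = 0 → X = ∅) :
    ∃ (H : AddSubgroup (ZMod n)) (c : ZMod n), ∃ W ⊆ B, ∃ o e : ℕ,
      (∀ i ∈ W, ρ i = 0 → v i ∈ H) ∧ (∀ i ∈ W, ρ i = 1 → v i - c ∈ H) ∧
      (B \ W).card ≤ 2 * (o + e) ∧ ((B \ W).filter fun i => ρ i = 0).card ≤ o + e ∧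
      (o + 1 + S.card) * Nat.card H ≤ n ∧ e + 1 ≤ Nat.card H ∧ ∑ i ∈ W, ε i * ρ i = 0 := by
  classical
  let g : Finset ι → ZMod n := fun y => 2 * ∑ i ∈ y, (ε i : ZMod n) * v i
  let fam : Finset (Finset (Finset ι)) := B.powerset.powerset.filter fun F =>
    (∀ y ∈ F, IsFlipItem ρ ε y) ∧ (F : Set (Finset ι)).PairwiseDisjoint id
  have hfam : ∀ F, F ∈ fam ↔ (∀ y ∈ F, y ⊆ B) ∧ (∀ y ∈ F, IsFlipItem ρ ε y) ∧
      (F : Set (Finset ι)).PairwiseDisjoint id := by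
    intro F
    simp only [fam, Finset.mem_filter, Finset.mem_powerset]
    refine and_congr_left fun _ => ⟨fun h y hy => Finset.mem_powerset.1 (h hy),
      fun h y hy => Finset.mem_powerset.2 (h y hy)⟩
  obtain ⟨F, hF, hmax⟩ := Finset.exists_max_image fam (fun F => (shiftedSums {0} g F).card)
    ⟨∅, by simp [hfam]⟩
  obtain ⟨hFB, hFi, hFd⟩ := (hfam F).1 hF
  have hsumY : ∀ Y ⊆ F, ∀ {R : Type} [CommRing R] (f : ι → R),
      ∑ i ∈ Y.biUnion id, f i = ∑ y ∈ Y, ∑ i ∈ y, f i := by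
    intro Y hY R _ f
    exact Finset.sum_biUnion (hFd.subset (by exact_mod_cast hY))
  obtain ⟨F', hF'F, hF'T, o, e, hcard, he, ho⟩ := exists_trim_of_zeroSumFree F g S h (by
    intro Y hY X hX h0
    refine hfree (Y.biUnion id) ?_ ?_ X hX ?_
    · exact Finset.biUnion_subset.2 fun y hy => hFB y (hY hy)
    · rw [hsumY Y hY]
      exact Finset.sum_eq_zero fun y hy => (hFi y (hY hy)).sum_eq_zero
    · rw [hsumY Y hY, Finset.mul_sum]
      exact h0)
  set T := shiftedSums {0} g F with hT
  set W := B \ F'.biUnion id with hW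
  have hBW : B \ W = F'.biUnion id := by
    rw [hW, Finset.sdiff_sdiff_eq_self]
    exact Finset.biUnion_subset.2 fun y hy => hFB y (hF'F hy)
  have hWsum : ∑ i ∈ W, ε i * ρ i = 0 := by
    have h1 := Finset.sum_sdiff (f := fun i => ε i * ρ i) (show W ⊆ B from Finset.sdiff_subset)
    rw [hBW, hsumY F' hF'F,
      Finset.sum_eq_zero (fun y hy => (hFi y (hF'F hy)).sum_eq_zero), hB, zero_add] at h1
    exact h1
  have hitem : ∀ y ⊆ W, IsFlipItem ρ ε y → g y ∈ stabAdd T := by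
    intro y hy hyi
    have hdis : ∀ z ∈ F', Disjoint y z := fun z hz => by
      refine Finset.disjoint_left.2 fun i hi hi' => ?_
      exact (Finset.mem_sdiff.1 (hy hi)).2 (Finset.mem_biUnion.2 ⟨z, hz, hi'⟩)
    have hyF' : y ∉ F' := fun h => hyi.nonempty.ne_empty (disjoint_self.1 (hdis y h))
    have hins : insert y F' ∈ fam := by
      refine (hfam _).2 ⟨?_, ?_, ?_⟩
      · intro z hz
        rcases Finset.mem_insert.1 hz with rfl | hz
        · exact hy.trans Finset.sdiff_subset
        · exact hFB z (hF'F hz)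
      · intro z hz
        rcases Finset.mem_insert.1 hz with rfl | hz
        · exact hyi
        · exact hFi z (hF'F hz)
      · rw [Finset.coe_insert]
        exact (hFd.subset (by exact_mod_cast hF'F)).insert fun z hz _ => hdis z hz
    have hle := hmax _ hins
    have heq : T = shiftedSums {0} g (insert y F') := by
      refine Finset.eq_of_subset_of_card_le ?_ hle
      rw [← hF'T]
      exact shiftedSums_mono (Finset.subset_insert _ _)
    rw [mem_stabAdd]
    intro t ht
    rw [heq, ← Finset.union_singleton, shiftedSums_union _ _ (by simpa using hyF'), hF'T]
    exact mem_shiftedSums.2 ⟨t, ht, {y}, Finset.Subset.refl _, by simp⟩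
  have hpm : ∀ p ∈ W, ∀ m ∈ W, ρ p = 1 → ρ m = 1 → ε p = 1 → ε m = -1 →
      v p - v m ∈ stabAdd T := by
    intro p hp m hm hρp hρm hεp hεm
    have h1 := hitem {p, m} (by
      intro i hi
      rcases Finset.mem_insert.1 hi with rfl | hi
      · exact hp
      · rwa [Finset.mem_singleton.1 hi]) (Or.inr ⟨p, m, rfl, hρp, hρm, hεp, hεm⟩)
    simp only [g] at h1
    rw [sum_pair_of_sign hεp hεm] at h1
    exact mem_of_two_mul_mem hodd h1
  have hc : ∃ c, ∀ i ∈ W, ρ i = 1 → v i - c ∈ stabAdd T := by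
    by_cases hr : ∃ i ∈ W, ρ i = 1
    · have key : ∀ i ∈ W, ρ i = 1 → ∃ j ∈ W, ρ j = 1 ∧ ε j = -ε i := by
        intro i hi hρi
        by_contra! hno
        have h1 : ∀ j ∈ W, ε j * ρ j = ε i * ρ j := by
          intro j hj
          rcases hρ j with h | h
          · rw [h, mul_zero, mul_zero]
          · have h2 := hno j hj h
            have h3 := hε i
            have h4 := hε j
            rw [show ε j = ε i by omega]
        rw [Finset.sum_congr rfl h1, ← Finset.mul_sum] at hWsum
        have h2 : ∑ j ∈ W, ρ j = 0 := by
          rcases hε i with h3 | h3 <;> rw [h3] at hWsum <;> omega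
        have h3 := (Finset.sum_eq_zero_iff_of_nonneg fun j _ => by
          rcases hρ j with h | h <;> omega).1 h2 i hi
        omega
      obtain ⟨p, hp, m, hm, hρp, hρm, hεp, hεm⟩ : ∃ p ∈ W, ∃ m ∈ W, ρ p = 1 ∧ ρ m = 1 ∧
          ε p = 1 ∧ ε m = -1 := by
        obtain ⟨i, hi, hρi⟩ := hr
        obtain ⟨j, hj, hρj, hεj⟩ := key i hi hρi
        rcases hε i with h3 | h3
        · exact ⟨i, hi, j, hj, hρi, hρj, h3, by omega⟩
        · exact ⟨j, hj, i, hi, hρj, hρi, by omega, h3⟩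
      refine ⟨v p, fun i hi hρi => ?_⟩
      have hpm' := hpm p hp m hm hρp hρm hεp hεm
      rcases hε i with h3 | h3
      · have := (stabAdd T).sub_mem (hpm i hi m hm hρi hρm h3 hεm) hpm'
        rwa [sub_sub_sub_cancel_right] at this
      · have := (stabAdd T).neg_mem (hpm p hp i hi hρp hρi hεp h3)
        rwa [neg_sub] at this
    · exact ⟨0, fun i hi hρi => absurd ⟨i, hi, hρi⟩ hr⟩
  obtain ⟨c, hc⟩ := hc
  refine ⟨stabAdd T, c, W, Finset.sdiff_subset, o, e, ?_, hc, ?_, ?_, ?_, he, hWsum⟩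
  · intro i hi hρi
    have h1 := hitem {i} (by simpa using hi) (Or.inl ⟨i, rfl, hρi⟩)
    simp only [g, Finset.sum_singleton] at h1
    have h2 := mem_of_two_mul_mem hodd h1
    rcases hε i with h | h <;> rw [h] at h2 <;> simpa using h2
  · rw [hBW, ← hcard, mul_comm]
    exact Finset.card_biUnion_le_card_mul _ _ _ fun y hy => (hFi y (hF'F hy)).card_le_two
  · rw [hBW, ← hcard, Finset.filter_biUnion]
    refine (Finset.card_biUnion_le_card_mul _ _ 1 fun y hy =>
      (hFi y (hF'F hy)).card_filter_le_one).trans (by simp)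
  · simpa using ho

end Packing

/-! ### Structure of signed zero sequences -/

section Structure

variable {n : ℕ} {ι σ : Type*} [DecidableEq σ]

theorem blockDefect_eq_card (C : Finset ι) (ρ : ι → ℤ) (blk : ι → Option σ) (ε : ι → ℤ)
    (hρ : ∀ i, ρ i = 0 ∨ ρ i = 1) (hε : ∀ i, ε i = 1 ∨ ε i = -1) (β : Option σ) :
    blockDefect C ρ blk ε β =
      (((C.filter fun i => ρ i = 1 ∧ ε i = 1).filter fun i => blk i = β).card : ℤ) -
        ((C.filter fun i => ρ i = 1 ∧ ε i = -1).filter fun i => blk i = β).card := by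
  rw [blockDefect, Finset.filter_filter, Finset.filter_filter, Finset.card_filter,
    Finset.card_filter]
  push_cast
  rw [← Finset.sum_sub_distrib]
  refine Finset.sum_congr rfl fun i _ => ?_
  rcases hρ i with h1 | h1 <;> rcases hε i with h2 | h2 <;> by_cases h3 : blk i = β <;>
    simp [h1, h2, h3]

theorem sum_blockDefect [Fintype σ] (C : Finset ι) (ρ : ι → ℤ) (blk : ι → Option σ) (ε : ι → ℤ) :
    ∑ β, blockDefect C ρ blk ε β = ∑ i ∈ C, ε i * ρ i := by
  simp only [blockDefect]
  rw [Finset.sum_comm]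
  refine Finset.sum_congr rfl fun i _ => ?_
  rw [← Finset.mul_sum, Finset.sum_ite_eq]
  simp

theorem even_blockDefect (C : Finset ι) (ρ : ι → ℤ) (blk : ι → Option σ) (ε : ι → ℤ)
    (hε : ∀ i, ε i = 1 ∨ ε i = -1) (β : Option σ)
    (h : Even (∑ i ∈ C, if blk i = β then ρ i else 0)) : Even (blockDefect C ρ blk ε β) := by
  have h1 : Even (∑ i ∈ C, (ε i - 1) * (if blk i = β then ρ i else 0)) := by
    refine Finset.even_sum _ fun i _ => Even.mul_right ?_ _
    rcases hε i with h | h <;> rw [h] <;> decide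
  have h2 := h1.add h
  rw [← Finset.sum_add_distrib] at h2
  rw [blockDefect]
  have h3 : ∀ i, ε i * (if blk i = β then ρ i else 0) =
      (ε i - 1) * (if blk i = β then ρ i else 0) + (if blk i = β then ρ i else 0) :=
    fun i => by ring
  simpa only [h3] using h2

/-- Structure of a signed zero sequence whose blocks cannot be removed: outside of a small set the
base block lies in a proper coset. -/
theorem exists_structure [DecidableEq ι] [Fintype σ] [NeZero n] [Nonempty ι] (hodd : Odd n)
    (C : Finset ι) (ρ : ι → ℤ) (v : ι → ZMod n) (blk : ι → Option σ)
    (hρ : ∀ i, ρ i = 0 ∨ ρ i = 1)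
    (heven : ∀ β : σ, Even (∑ i ∈ C, if blk i = some β then ρ i else 0))
    (hex : ∃ ε, SignedZero ρ v ε C)
    (hmin : ∀ I : Finset σ, I.Nonempty → ∀ ε',
      ¬ SignedZero ρ v ε' (C.filter fun i => ∀ β ∈ I, blk i ≠ some β)) :
    ∃ (ε : ι → ℤ) (H : AddSubgroup (ZMod n)) (c : ZMod n) (W : Finset ι) (o e s D : ℕ),
      SignedZero ρ v ε C ∧ W ⊆ C.filter (fun i => blk i = none) ∧
      (∀ i ∈ W, ρ i = 0 → v i ∈ H) ∧ (∀ i ∈ W, ρ i = 1 → v i - c ∈ H) ∧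
      (C.filter (fun i => blk i = none) \ W).card ≤ 2 * (o + e) + D ∧
      ((C.filter (fun i => blk i = none) \ W).filter fun i => ρ i = 0).card ≤ o + e ∧
      (o + 1 + s) * Nat.card H ≤ n ∧ e + 1 ≤ Nat.card H ∧
      2 * Fintype.card σ + D ≤ 2 * s + 2 ∧ (Nonempty σ → 1 ≤ s) ∧
      ∑ i ∈ W, ε i * ρ i = 0 ∧
      (2 * Fintype.card σ + D ≤ 2 * s ∨ ∃ i ∈ C \ W, ρ i = 1) := by
  classical
  obtain ⟨ε, hz, hopt⟩ : ∃ ε, SignedZero ρ v ε C ∧ ∀ ε', SignedZero ρ v ε' C →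
      ∑ β, (blockDefect C ρ blk ε β).natAbs ≤ ∑ β, (blockDefect C ρ blk ε' β).natAbs := by
    let m : (ι → ℤ) → ℕ := fun ε => ∑ β, (blockDefect C ρ blk ε β).natAbs
    have hne : {ε | SignedZero ρ v ε C}.Nonempty := hex
    exact ⟨Function.argminOn m _ hne, Function.argminOn_mem m _ hne,
      fun ε' h => Function.argminOn_le m _ h⟩
  set d := blockDefect C ρ blk ε with hd
  have hdsum : ∑ β, d β = 0 := by rw [hd, sum_blockDefect, hz.2.1]
  have hdsome : ∀ β, Even (d (some β)) := fun β => even_blockDefect C ρ blk ε hz.1 _ (heven β)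
  have hdeven : ∀ β, Even (d β) := by
    rintro (_ | β)
    · rw [Fintype.sum_option] at hdsum
      have h1 : Even (∑ β, d (some β)) := Finset.even_sum _ fun β _ => hdsome β
      rw [show d none = -∑ β, d (some β) by omega]
      exact h1.neg
    · exact hdsome β
  set P := C.filter fun i => ρ i = 1 ∧ ε i = 1 with hP
  set M := C.filter fun i => ρ i = 1 ∧ ε i = -1 with hM
  have hdcard : ∀ β, d β = ((P.filter fun i => blk i = β).card : ℤ) -
      (M.filter fun i => blk i = β).card := blockDefect_eq_card C ρ blk ε hρ hz.1
  obtain ⟨A, hAP, hA⟩ := exists_subset_fiber_card P blk (fun β => (d β).toNat)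
    fun β => by have := hdcard β; omega
  obtain ⟨A', hAM, hA'⟩ := exists_subset_fiber_card M blk (fun β => (-d β).toNat)
    fun β => by have := hdcard β; omega
  have hAcard : A.card = ∑ β, (d β).toNat := by
    rw [Finset.card_eq_sum_card_fiberwise (f := blk) (t := Finset.univ) (by simp)]
    exact Finset.sum_congr rfl fun β _ => hA β
  have hA'card : A'.card = ∑ β, (-d β).toNat := by
    rw [Finset.card_eq_sum_card_fiberwise (f := blk) (t := Finset.univ) (by simp)]
    exact Finset.sum_congr rfl fun β _ => hA' β
  have hcardeq : A'.card = A.card := by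
    have h1 : ∑ β, d β = ∑ β, (((d β).toNat : ℤ) - ((-d β).toNat : ℤ)) :=
      Finset.sum_congr rfl fun β _ => by omega
    rw [hdsum, Finset.sum_sub_distrib] at h1
    rw [hAcard, hA'card]
    have h2 := h1
    push_cast [← Nat.cast_sum] at h2
    zify
    linarith
  obtain ⟨hNeven, a, hainj, haim, hap⟩ := exists_paired_enumeration blk A fun β => by
    rw [hA]
    obtain ⟨k, hk⟩ := hdeven β
    exact ⟨k.toNat, by omega⟩
  obtain ⟨-, b, hbinj, hbim, hbp⟩ := exists_paired_enumeration blk A' fun β => by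
    rw [hA']
    obtain ⟨k, hk⟩ := hdeven β
    exact ⟨(-k).toNat, by omega⟩
  have hafib := fun β => (card_filter_range_eq blk hainj haim β).trans (hA β)
  have hbfib := fun β => (card_filter_range_eq blk hbinj hbim β).trans (hA' β)
  rw [hcardeq] at hbinj hbim hbp hbfib
  set N := A.card with hN
  have haA : ∀ t < N, a t ∈ A := fun t ht => by
    rw [← haim]
    exact Finset.mem_image_of_mem _ (Finset.mem_range.2 ht)
  have hbA : ∀ t < N, b t ∈ A' := fun t ht => by
    rw [← hbim]
    exact Finset.mem_image_of_mem _ (Finset.mem_range.2 ht)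
  have haP : ∀ i ∈ A, i ∈ C ∧ ρ i = 1 ∧ ε i = 1 := fun i hi => Finset.mem_filter.1 (hAP hi)
  have hbM : ∀ i ∈ A', i ∈ C ∧ ρ i = 1 ∧ ε i = -1 := fun i hi => Finset.mem_filter.1 (hAM hi)
  set base := C.filter fun i => blk i = none with hbase
  set U := (A ∪ A').filter fun i => blk i = none with hU
  have hUbase : U ⊆ base := by
    intro i hi
    obtain ⟨h1, h2⟩ := Finset.mem_filter.1 hi
    refine Finset.mem_filter.2 ⟨?_, h2⟩
    rcases Finset.mem_union.1 h1 with h | h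
    · exact (haP i h).1
    · exact (hbM i h).1
  have hUsplit : U = (A.filter fun i => blk i = none) ∪ A'.filter fun i => blk i = none :=
    Finset.filter_union _ _ _
  have hUdisj : Disjoint (A.filter fun i => blk i = none) (A'.filter fun i => blk i = none) := by
    refine Finset.disjoint_left.2 fun i hi hi' => ?_
    have h1 := (haP i (Finset.mem_filter.1 hi).1).2.2
    have h2 := (hbM i (Finset.mem_filter.1 hi').1).2.2
    omega
  have hUcard : U.card = (d none).natAbs := by
    rw [hUsplit, Finset.card_union_of_disjoint hUdisj, hA, hA']
    omega
  have hUsum : ∑ i ∈ U, ε i * ρ i = d none := by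
    rw [hUsplit, Finset.sum_union hUdisj]
    rw [Finset.sum_congr (s₁ := A.filter _) (g := fun _ => (1 : ℤ)) rfl fun i hi => by
      have := haP i (Finset.mem_filter.1 hi).1
      rw [this.2.1, this.2.2, mul_one]]
    rw [Finset.sum_congr (s₁ := A'.filter _) (g := fun _ => (-1 : ℤ)) rfl fun i hi => by
      have := hbM i (Finset.mem_filter.1 hi).1
      rw [this.2.1, this.2.2, mul_one]]
    rw [Finset.sum_const, Finset.sum_const, hA, hA']
    simp only [nsmul_eq_mul]
    omega
  have hbasesum : ∑ i ∈ base, ε i * ρ i = d none := by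
    rw [hd, blockDefect, hbase, Finset.sum_filter]
    exact Finset.sum_congr rfl fun i _ => by split_ifs <;> simp
  set B := base \ U with hB
  have hBsum : ∑ i ∈ B, ε i * ρ i = 0 := by
    have := Finset.sum_sdiff (f := fun i => ε i * ρ i) hUbase
    rw [hUsum, hbasesum] at this
    rw [hB]
    omega
  set Q := Finset.univ.filter fun β : σ => d (some β) = 0 with hQ
  let h : ℕ ⊕ σ → ZMod n := Sum.elim (fun t => 2 * (v (a t) - v (b (t + 1))))
    fun β => ∑ i ∈ C, (ε i : ZMod n) * (if blk i = some β then v i else 0)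
  have hBnone : ∀ i ∈ B, i ∈ C ∧ blk i = none := fun i hi =>
    Finset.mem_filter.1 (Finset.mem_sdiff.1 hi).1
  have hBA : ∀ i ∈ B, i ∉ A ∪ A' := fun i hi hi' =>
    (Finset.mem_sdiff.1 hi).2 (Finset.mem_filter.2 ⟨hi', (hBnone i hi).2⟩)
  obtain ⟨H, c, W, hWB, o, e, hW0, hW1, hWcard, hWrot, hH, he, hWsum⟩ :=
    exists_packing hodd B ρ ε v hρ hz.1 hBsum ((Finset.range (N - 1)).disjSum Q) h (by
      intro Z hZ hZ0 X hX hsum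
      have key := exchange_zeroSumFree C ρ v blk ε hz hopt hmin N hNeven a b
        (fun t ht => haP _ (haA t ht)) (fun t ht => hbM _ (hbA t ht)) hainj hbinj hap hbp
        hafib hbfib Z (fun i hi => (hBnone i (hZ hi)).1) (fun i hi => (hBnone i (hZ hi)).2) hZ0
        (fun t ht hi => hBA _ (hZ hi) (Finset.mem_union_left _ (haA t ht)))
        (fun t ht hi => hBA _ (hZ hi) (Finset.mem_union_right _ (hbA t ht)))
        X.toLeft (fun t ht => by simpa using hX (Finset.mem_toLeft.1 ht)) X.toRight
        (fun β hβ => by simpa [hQ] using hX (Finset.mem_toRight.1 hβ)) (by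
          refine Eq.trans ?_ hsum
          congr 1
          conv_rhs => rw [← Finset.toLeft_disjSum_toRight (u := X), Finset.sum_disjSum]
          rfl)
      rw [← Finset.toLeft_disjSum_toRight (u := X), key.1, key.2]
      rfl)
  rw [Finset.card_disjSum, Finset.card_range] at hH
  have hbaseW : base \ W ⊆ (B \ W) ∪ U := by
    intro i hi
    obtain ⟨h1, h2⟩ := Finset.mem_sdiff.1 hi
    by_cases h3 : i ∈ U
    · exact Finset.mem_union_right _ h3
    · exact Finset.mem_union_left _ (Finset.mem_sdiff.2 ⟨Finset.mem_sdiff.2 ⟨h1, h3⟩, h2⟩)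
  have hcount : 2 * Fintype.card σ + (d none).natAbs ≤ 2 * N + 2 * Q.card := by
    have h1 : 2 * N = ∑ β, (d β).natAbs := by
      rw [two_mul]
      nth_rewrite 2 [← hcardeq]
      rw [hAcard, hA'card, ← Finset.sum_add_distrib]
      exact Finset.sum_congr rfl fun β _ => by omega
    rw [Fintype.sum_option] at h1
    have h2 : 2 * Fintype.card σ ≤ ∑ β : σ, ((d (some β)).natAbs +
        2 * if d (some β) = 0 then 1 else 0) := by
      rw [← Finset.card_univ, mul_comm, ← smul_eq_mul]
      refine Finset.card_nsmul_le_sum _ _ _ fun β _ => ?_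
      obtain ⟨k, hk⟩ := hdsome β
      split_ifs <;> omega
    rw [Finset.sum_add_distrib, ← Finset.mul_sum, ← Finset.card_filter, ← hQ] at h2
    omega
  refine ⟨ε, H, c, W, o, e, N - 1 + Q.card, (d none).natAbs, hz,
    hWB.trans Finset.sdiff_subset, hW0, hW1, ?_, ?_, hH, he, ?_, ?_, hWsum, ?_⟩
  · have h1 := Finset.card_le_card hbaseW
    have h2 := Finset.card_union_le (B \ W) U
    omega
  · refine (Finset.card_le_card fun i hi => ?_).trans hWrot
    obtain ⟨h1, h2⟩ := Finset.mem_filter.1 hi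
    rcases Finset.mem_union.1 (hbaseW h1) with h3 | h3
    · exact Finset.mem_filter.2 ⟨h3, h2⟩
    · rcases Finset.mem_union.1 (Finset.mem_filter.1 h3).1 with h4 | h4
      · have := (haP i h4).2.1
        omega
      · have := (hbM i h4).2.1
        omega
  · omega
  · rintro ⟨β⟩
    have : 0 < Fintype.card σ := Fintype.card_pos_iff.2 ⟨β⟩
    obtain ⟨k, hk⟩ := hNeven
    omega
  · rcases Nat.eq_zero_or_pos N with h0 | h0
    · left
      omega
    · right
      have h1 := haA 0 h0
      refine ⟨a 0, Finset.mem_sdiff.2 ⟨(haP _ h1).1, fun h2 => ?_⟩, (haP _ h1).2.1⟩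
      exact hBA _ (hWB h2) (Finset.mem_union_left _ h1)

end Structure

/-! ### Minimal families of atoms -/

section Family

variable {n : ℕ} {ι κ : Type*} [DecidableEq ι]

theorem IsAtomSeq.eq_singleton_of_one {G : Type*} [Group G] {x : ι → G} {U : Finset ι}
    (hU : IsAtomSeq (U.val.map x)) {i : ι} (hi : i ∈ U) (h1 : x i = 1) : U = {i} := by
  have hS : ({i} : Finset ι) ⊆ U := Finset.singleton_subset_iff.2 hi
  obtain ⟨l, hl, hp⟩ := hU.2.1
  have hmem : (1 : G) ∈ l := by
    rw [← Multiset.mem_coe, hl, ← h1]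
    exact Multiset.mem_map_of_mem x hi
  obtain ⟨l₁, l₂, rfl⟩ := List.append_of_mem hmem
  have h2 : IsProductOne ((U \ {i}).val.map x) := by
    refine ⟨l₁ ++ l₂, ?_, by simpa using hp⟩
    have h3 : U.val.map x = 1 ::ₘ (U \ {i}).val.map x := by
      rw [← h1, ← Multiset.map_cons x, ← Finset.insert_val_of_notMem (by simp),
        Finset.sdiff_singleton_eq_erase, Finset.insert_erase hi]
    rw [h3, ← Multiset.coe_add, ← Multiset.cons_coe, Multiset.add_cons,
      Multiset.cons_inj_right] at hl
    simpa using hl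
  rcases hU.subset_trivial hS ⟨[1], by simp [h1], by simp⟩ h2 with h | h
  · simp at h
  · exact Finset.Subset.antisymm (Finset.sdiff_eq_empty_iff_subset.1 h) hS

theorem exists_ne_reflection (x : ι → DihedralGroup n) {A : Finset ι}
    (hA : IsProductOne (A.val.map x)) {u : ι} (hu : u ∈ A) (hρ : reflInd (x u) = 1) :
    ∃ w ∈ A, w ≠ u ∧ reflInd (x w) = 1 := by
  by_contra! hno
  have h1 := even_sum_reflInd x A hA
  rw [Finset.sum_eq_single u, hρ] at h1
  · exact absurd h1 (by decide)
  · exact fun w hw hne => (reflInd_eq_zero_or_one _).resolve_right (hno w hw hne)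
  · exact fun h => absurd hu h

theorem IsAtomSeq.eq_pair_of_reflection {x : ι → DihedralGroup n} [NeZero n] {A : Finset ι}
    (hA : IsAtomSeq (A.val.map x)) {c : ZMod n} (hx : ∀ i ∈ A, x i = 1 ∨ x i = .sr c) {u : ι}
    (hu : u ∈ A) (hρ : reflInd (x u) = 1) :
    ∃ w ∈ A, w ≠ u ∧ A = {u, w} ∧ x u = .sr c ∧ x w = .sr c := by
  obtain ⟨w, hw, hwu, hρw⟩ := exists_ne_reflection x hA.2.1 hu hρ
  have hrefl : ∀ i ∈ A, reflInd (x i) = 1 → x i = .sr c := fun i hi h =>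
    (hx i hi).resolve_left fun h1 => by simp [h1] at h
  refine ⟨w, hw, hwu, ?_, hrefl u hu hρ, hrefl w hw hρw⟩
  have hcard := card_le_of_isAtomSeq (Subgroup.zpowers (DihedralGroup.sr c)) hA (by
    intro g hg
    obtain ⟨i, hi, rfl⟩ := Multiset.mem_map.1 hg
    rcases hx i hi with h | h
    · rw [h]
      exact one_mem _
    · rw [h]
      exact Subgroup.mem_zpowers _)
  rw [Nat.card_zpowers, DihedralGroup.orderOf_sr, Multiset.card_map, Finset.card_val] at hcard
  refine (Finset.eq_of_subset_of_card_le ?_ ?_).symm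
  · intro i hi
    rcases Finset.mem_insert.1 hi with rfl | hi
    · exact hu
    · rwa [Finset.mem_singleton.1 hi]
  · rwa [Finset.card_pair hwu.symm]

/-- If all but one term of a product-one sequence lie in a coset subgroup, then so does the last. -/
theorem mem_class_of_others {x : ι → DihedralGroup n} {A : Finset ι}
    (hA : IsProductOne (A.val.map x)) {H : AddSubgroup (ZMod n)} {c : ZMod n} {u : ι} (hu : u ∈ A)
    (h : ∀ i ∈ A, i ≠ u → dihIdx (x i) - (reflInd (x i) : ZMod n) * c ∈ H) :
    dihIdx (x u) - (reflInd (x u) : ZMod n) * c ∈ H := by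
  obtain ⟨ε, hε, h0, h1⟩ := exists_sign_of_isProductOne x A hA
  have hpm : ∀ i (z : ZMod n), (ε i : ZMod n) * z ∈ H ↔ z ∈ H := by
    intro i z
    rcases hε i with h | h <;> rw [h] <;> simp
  have hsum : ∑ i ∈ A, (ε i : ZMod n) * (dihIdx (x i) - (reflInd (x i) : ZMod n) * c) = 0 := by
    have h0' := congrArg (Int.cast : ℤ → ZMod n) h0
    push_cast at h0'
    simp only [mul_sub, Finset.sum_sub_distrib, ← mul_assoc, ← Finset.sum_mul]
    rw [h1, h0']
    simp
  rw [← Finset.add_sum_erase _ _ hu] at hsum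
  rw [← hpm u, eq_neg_of_add_eq_zero_left hsum]
  refine H.neg_mem (H.sum_mem fun i hi => ?_)
  rw [hpm]
  exact h i (Finset.mem_of_mem_erase hi) (Finset.ne_of_mem_erase hi)

variable [Fintype ι] [Fintype κ] [DecidableEq κ]

theorem exists_structure_of_family [NeZero n] (hodd : Odd n) (own : ι → κ)
    (x : ι → DihedralGroup n) (U : Finset ι)
    (hA : ∀ k, IsAtomSeq ((Finset.univ.filter fun i => own i = k).val.map x))
    (hC : IsProductOne (Uᶜ.val.map x))
    (hmin : ∀ I : Finset κ, I.Nonempty → ∀ S ⊆ Uᶜ,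
      S.val.map x = (Finset.univ.filter fun i => own i ∈ I).val.map x →
      ¬ IsProductOne ((Uᶜ \ S).val.map x))
    (J : Finset κ) (hJ : ∀ i ∈ U, own i ∈ J)
    (hr : ∃ i ∈ Uᶜ, own i ∈ J ∧ reflInd (x i) = 1) :
    ∃ (ε : ι → ℤ) (H : AddSubgroup (ZMod n)) (c : ZMod n) (W : Finset ι) (o e s D : ℕ),
      SignedZero (fun i => reflInd (x i)) (fun i => dihIdx (x i)) ε Uᶜ ∧
      W ⊆ Uᶜ.filter (fun i => own i ∈ J) ∧
      (∀ i ∈ W, dihIdx (x i) - (reflInd (x i) : ZMod n) * c ∈ H) ∧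
      (Uᶜ.filter (fun i => own i ∈ J) \ W).card ≤ 2 * (o + e) + D ∧
      ((Uᶜ.filter (fun i => own i ∈ J) \ W).filter fun i => reflInd (x i) = 0).card ≤ o + e ∧
      (o + 1 + s) * Nat.card H ≤ n ∧ e + 1 ≤ Nat.card H ∧
      2 * Jᶜ.card + D ≤ 2 * s + 2 ∧ (Jᶜ.Nonempty → 1 ≤ s) ∧
      ∑ i ∈ W, ε i * reflInd (x i) = 0 ∧
      (2 * Jᶜ.card + D ≤ 2 * s ∨ ∃ i ∈ Uᶜ \ W, reflInd (x i) = 1) := by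
  classical
  let blk : ι → Option {k // k ∈ Jᶜ} := fun i =>
    if h : own i ∈ Jᶜ then some ⟨own i, h⟩ else none
  have hblk : ∀ i (β : {k // k ∈ Jᶜ}), blk i = some β ↔ own i = β.1 := by
    intro i β
    simp only [blk]
    split_ifs with h
    · rw [Option.some_inj, Subtype.ext_iff]
    · simp only [false_iff]
      intro h1
      exact h (h1 ▸ β.2)
  have hblk0 : ∀ i, blk i = none ↔ own i ∈ J := by
    intro i
    simp only [blk]
    split_ifs with h
    · simpa using h
    · simpa using h
  obtain ⟨i₀, hi₀C, hi₀J, hi₀⟩ := hr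
  have hspare : ∀ i, own i ∉ J → i ∈ Uᶜ := fun i hi =>
    Finset.mem_compl.2 fun h => hi (hJ i h)
  have : Nonempty ι := ⟨i₀⟩
  obtain ⟨ε, H, c, W, o, e, s, D, hz, hWC, hW0, hW1, hWc, hWr, hH, he, hs, hs1, hW, hf⟩ :=
    exists_structure hodd Uᶜ (fun i => reflInd (x i)) (fun i => dihIdx (x i)) blk
      (fun i => reflInd_eq_zero_or_one _) (by
        intro β
        rw [← Finset.sum_filter]
        have h1 : (Uᶜ.filter fun i => blk i = some β) =
            Finset.univ.filter fun i => own i = β.1 := by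
          ext i
          simp only [Finset.mem_filter, hblk, Finset.mem_univ, true_and, and_iff_right_iff_imp]
          intro h
          exact hspare i (h ▸ Finset.mem_compl.1 β.2)
        rw [h1]
        exact even_sum_reflInd x _ (hA β.1).2.1) (exists_sign_of_isProductOne x _ hC) (by
        rintro I ⟨β, hβ⟩ ε' ⟨hε', h0, h1⟩
        have hS : Finset.univ.filter (fun i => own i ∈ I.map (Function.Embedding.subtype _)) ⊆
            Uᶜ := by
          intro i hi
          obtain ⟨γ, -, hγ⟩ := Finset.mem_map.1 (Finset.mem_filter.1 hi).2
          exact hspare i (by rw [← hγ]; exact Finset.mem_compl.1 γ.2)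
        refine hmin (I.map (Function.Embedding.subtype _)) ⟨β.1, Finset.mem_map_of_mem _ hβ⟩ _ hS
          rfl ?_
        have h2 : Uᶜ \ Finset.univ.filter (fun i => own i ∈ I.map (Function.Embedding.subtype _)) =
            Uᶜ.filter fun i => ∀ β ∈ I, blk i ≠ some β := by
          ext i
          simp only [Finset.mem_sdiff, Finset.mem_filter, Finset.mem_univ, true_and,
            Finset.mem_map, not_exists, not_and, ne_eq, hblk]
          exact and_congr_right fun _ => ⟨fun h γ hγ h' => h γ hγ h'.symm,
            fun h γ hγ h' => h γ hγ h'.symm⟩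
        rw [h2]
        refine isProductOne_of_sign x ε' hε' _ h0 h1 ⟨i₀, Finset.mem_filter.2 ⟨hi₀C, ?_⟩, hi₀⟩
        intro β _ h
        rw [(hblk0 i₀).2 hi₀J] at h
        simp at h)
  simp only [hblk0] at hWC hWc hWr
  rw [Fintype.card_coe] at hs hf
  refine ⟨ε, H, c, W, o, e, s, D, hz, hWC, ?_, hWc, hWr, hH, he, hs, ?_, hW, hf⟩
  · intro i hi
    rcases reflInd_eq_zero_or_one (x i) with h | h
    · rw [h]
      simpa using hW0 i hi h
    · rw [h]
      simpa using hW1 i hi h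
  · rintro ⟨k, hk⟩
    exact hs1 ⟨⟨k, hk⟩⟩

end Family

section Assembly

theorem card_le_two_mul_of_isAtomSeq {n : ℕ} [NeZero n] {ι : Type*} {x : ι → DihedralGroup n}
    {U : Finset ι} (hU : IsAtomSeq (U.val.map x)) :
    U.card ≤ 2 * n := by
  have h := card_le_of_isAtomSeq ⊤ hU fun g _ => Subgroup.mem_top g
  rwa [Subgroup.card_top, DihedralGroup.nat_card, Multiset.card_map, Finset.card_val] at h

theorem card_le_of_isAtomSeq_rotations {n : ℕ} [NeZero n] {ι : Type*} {x : ι → DihedralGroup n}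
    {U : Finset ι} (hU : IsAtomSeq (U.val.map x)) (h : ∀ i ∈ U, reflInd (x i) ≠ 1) :
    U.card ≤ n := by
  have h1 := card_le_of_isAtomSeq (Subgroup.zpowers (DihedralGroup.r 1)) hU (by
    intro g hg
    obtain ⟨i, hi, rfl⟩ := Multiset.mem_map.1 hg
    rw [eq_r_of_reflInd (h i hi)]
    exact ⟨((dihIdx (x i)).val : ℤ), by simp⟩)
  rwa [Nat.card_zpowers, DihedralGroup.orderOf_r_one, Multiset.card_map, Finset.card_val] at h1

variable {n : ℕ} {ι κ : Type*} [DecidableEq ι] [Fintype ι] [DecidableEq κ]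

/-- Counting the members of `U` all of whose siblings lie in `W`. -/
theorem two_mul_card_image_le (own : ι → κ) (U W : Finset ι) :
    2 * (U.image own).card ≤ U.card +
      (U.filter fun u => ∀ i, own i = own u → i ≠ u → i ∈ W).card +
      ((U.image own).filter fun k => ∃ i ∈ Uᶜ, own i = k ∧ i ∉ W).card := by
  classical
  set V := U.filter fun u => ∀ i, own i = own u → i ≠ u → i ∈ W
  have hVU : V ⊆ U := Finset.filter_subset _ _
  rw [Finset.card_eq_sum_card_image own U,
    Finset.card_eq_sum_card_fiberwise (f := own) (s := V) (t := U.image own)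
      (fun i hi => by simpa using ⟨i, hVU hi, rfl⟩),
    Finset.card_filter, ← Finset.sum_add_distrib, ← Finset.sum_add_distrib, mul_comm,
    ← smul_eq_mul]
  refine Finset.card_nsmul_le_sum _ _ _ fun k hk => ?_
  obtain ⟨u, hu, rfl⟩ := Finset.mem_image.1 hk
  have hmem : u ∈ U.filter fun i => own i = own u := Finset.mem_filter.2 ⟨hu, rfl⟩
  have hpos := Finset.card_pos.2 ⟨u, hmem⟩
  by_cases h2 : 2 ≤ (U.filter fun i => own i = own u).card
  · omega
  by_cases hq : ∃ i ∈ Uᶜ, own i = own u ∧ i ∉ W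
  · rw [if_pos hq]
    omega
  have huV : u ∈ V.filter fun i => own i = own u := by
    refine Finset.mem_filter.2 ⟨Finset.mem_filter.2 ⟨hu, fun i hi hne => ?_⟩, rfl⟩
    by_contra hW
    refine hq ⟨i, Finset.mem_compl.2 fun hiU => hne ?_, hi, hW⟩
    exact Finset.card_le_one.1 (by omega) i (Finset.mem_filter.2 ⟨hiU, hi⟩) u hmem
  have := Finset.card_pos.2 ⟨u, huV⟩
  omega

theorem eq_one_or_eq_sr {g : DihedralGroup n} {c : ZMod n}
    (h : dihIdx g - (reflInd g : ZMod n) * c = 0) : g = 1 ∨ g = .sr c := by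
  rcases g with i | i
  · left
    have : i = 0 := by simpa [dihIdx, reflInd] using h
    rw [this, DihedralGroup.one_def]
  · right
    have : i - c = 0 := by simpa [dihIdx, reflInd] using h
    rw [sub_eq_zero.1 this]

variable {own : ι → κ} {x : ι → DihedralGroup n} {U : Finset ι}

theorem exists_ne_one_of_minimal [Fintype κ]
    (hA : ∀ k, IsAtomSeq ((Finset.univ.filter fun i => own i = k).val.map x))
    (hmin : ∀ I : Finset κ, I.Nonempty → ∀ S ⊆ Uᶜ,
      S.val.map x = (Finset.univ.filter fun i => own i ∈ I).val.map x →
      ¬ IsProductOne ((Uᶜ \ S).val.map x))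
    (hne : (U.image own)ᶜ.Nonempty) :
    ∃ i ∈ Uᶜ, own i ∈ U.image own ∧ x i ≠ 1 := by
  by_contra! hno
  have hout : ∀ i ∈ Uᶜ, own i ∉ U.image own := by
    intro i hi hiJ
    have h1 := hno i hi hiJ
    have h2 := (hA (own i)).eq_singleton_of_one (Finset.mem_filter.2 ⟨Finset.mem_univ i, rfl⟩) h1
    obtain ⟨u, hu, huo⟩ := Finset.mem_image.1 hiJ
    have h3 : u ∈ Finset.univ.filter fun j => own j = own i := by simpa using huo
    rw [h2, Finset.mem_singleton] at h3
    exact Finset.mem_compl.1 hi (h3 ▸ hu)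
  have hS : Finset.univ.filter (fun i => own i ∈ (U.image own)ᶜ) = Uᶜ := by
    ext i
    rw [Finset.mem_filter, Finset.mem_compl]
    refine ⟨fun h => Finset.mem_compl.2 fun hi => h.2 (Finset.mem_image_of_mem _ hi),
      fun h => ⟨Finset.mem_univ _, hout i h⟩⟩
  refine hmin _ hne Uᶜ (Finset.Subset.refl _) (by rw [hS]) ?_
  rw [sdiff_self]
  exact ⟨[], by simp, by simp⟩

theorem exists_sibling_of_class_bot [NeZero n]
    (hA : ∀ k, IsAtomSeq ((Finset.univ.filter fun i => own i = k).val.map x))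
    (hU : IsAtomSeq (U.val.map x)) (hr : ∃ i ∈ U, reflInd (x i) = 1) {W : Finset ι} {c : ZMod n}
    (hW : ∀ i ∈ W, dihIdx (x i) - (reflInd (x i) : ZMod n) * c = 0) {u : ι} (hu : u ∈ U)
    (huW : ∀ i, own i = own u → i ≠ u → i ∈ W) :
    ∃ w ∈ W, own w = own u ∧ (Finset.univ.filter fun i => own i = own u) = {u, w} ∧ w ≠ u ∧
      x u = .sr c ∧ x w = .sr c := by
  have huA : u ∈ Finset.univ.filter fun i => own i = own u := by simp
  have h1 := mem_class_of_others (H := ⊥) (c := c) (hA (own u)).2.1 huA fun i hi hne => by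
    simpa using hW i (huW i (Finset.mem_filter.1 hi).2 hne)
  have hx : ∀ i ∈ Finset.univ.filter (fun i => own i = own u), x i = 1 ∨ x i = .sr c := by
    intro i hi
    by_cases hiu : i = u
    · rw [hiu]
      exact eq_one_or_eq_sr (by simpa using h1)
    · exact eq_one_or_eq_sr (hW i (huW i (Finset.mem_filter.1 hi).2 hiu))
  have hρ : reflInd (x u) = 1 := by
    rcases hx u huA with h | h
    · obtain ⟨i, hi, hi1⟩ := hr
      rw [hU.eq_singleton_of_one hu h, Finset.mem_singleton] at hi
      rw [hi, h] at hi1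
      simp at hi1
    · rw [h]
      rfl
  obtain ⟨w, hw, hwu, hpair, hxu, hxw⟩ := (hA (own u)).eq_pair_of_reflection hx huA hρ
  have hwo := (Finset.mem_filter.1 hw).2
  exact ⟨w, huW w hwo hwu, hwo, hpair, hwu, hxu, hxw⟩

/-- In a minimal family whose complement of `U` has no reflections there are no spare members. -/
theorem compl_image_eq_empty_of_rotations [Fintype κ]
    (hA : ∀ k, IsAtomSeq ((Finset.univ.filter fun i => own i = k).val.map x))
    (hC : IsProductOne (Uᶜ.val.map x))
    (hmin : ∀ I : Finset κ, I.Nonempty → ∀ S ⊆ Uᶜ,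
      S.val.map x = (Finset.univ.filter fun i => own i ∈ I).val.map x →
      ¬ IsProductOne ((Uᶜ \ S).val.map x))
    (hrot : ∀ i ∈ Uᶜ, reflInd (x i) ≠ 1) : (U.image own)ᶜ = ∅ := by
  by_contra hne
  set I := (U.image own)ᶜ with hI
  have hS : Finset.univ.filter (fun i => own i ∈ I) ⊆ Uᶜ := by
    intro i hi
    refine Finset.mem_compl.2 fun h => ?_
    exact Finset.mem_compl.1 (Finset.mem_filter.1 hi).2 (Finset.mem_image_of_mem _ h)
  refine hmin I (Finset.nonempty_iff_ne_empty.2 hne) _ hS rfl ?_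
  rw [isProductOne_rotations_iff x _ fun i hi => hrot i (Finset.mem_sdiff.1 hi).1]
  have h1 := Finset.sum_sdiff (f := fun i => dihIdx (x i)) hS
  rw [(isProductOne_rotations_iff x _ hrot).1 hC] at h1
  have h2 : ∑ i ∈ Finset.univ.filter (fun i => own i ∈ I), dihIdx (x i) = 0 := by
    rw [← Finset.sum_fiberwise_of_maps_to (t := I) (g := own)
      fun i hi => (Finset.mem_filter.1 hi).2]
    refine Finset.sum_eq_zero fun k hk => ?_
    have h3 : ((Finset.univ.filter fun i => own i ∈ I).filter fun i => own i = k) =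
        Finset.univ.filter fun i => own i = k := by
      ext i
      simp only [Finset.mem_filter, Finset.mem_univ, true_and, and_iff_right_iff_imp]
      rintro rfl
      exact hk
    rw [h3, ← isProductOne_rotations_iff x]
    · exact (hA k).2.1
    · intro i hi
      refine hrot i (hS (Finset.mem_filter.2 ⟨Finset.mem_univ _, ?_⟩))
      rwa [(Finset.mem_filter.1 hi).2]
  rwa [h2, add_zero] at h1

end Assembly

/-! ### The upper bound for minimal families -/

section Main

variable {n : ℕ} {ι κ : Type*} [DecidableEq ι] [Fintype ι] [DecidableEq κ]
  {own : ι → κ} {x : ι → DihedralGroup n} {U : Finset ι}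

theorem card_eq_one_or_three_le [NeZero n] (hodd : Odd n) (H : AddSubgroup (ZMod n)) :
    H = ⊥ ∨ 3 ≤ Nat.card H := by
  have h1 : Nat.card H * H.index = n := by rw [H.card_mul_index, Nat.card_zmod]
  have h2 : Odd (Nat.card H) := Odd.of_dvd_nat hodd ⟨_, h1.symm⟩
  obtain ⟨k, hk⟩ := h2
  rcases Nat.eq_zero_or_pos k with rfl | hk0
  · exact Or.inl (AddSubgroup.card_eq_one.1 (by omega))
  · exact Or.inr (by omega)

theorem card_filter_siblings_le [NeZero n]
    (hA : ∀ k, IsAtomSeq ((Finset.univ.filter fun i => own i = k).val.map x))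
    (hU : IsAtomSeq (U.val.map x)) (hr : ∃ i ∈ U, reflInd (x i) = 1)
    {H : AddSubgroup (ZMod n)} (hH : 2 ≤ H.index) {c : ZMod n} {W : Finset ι}
    (hW : ∀ i ∈ W, dihIdx (x i) - (reflInd (x i) : ZMod n) * c ∈ H) :
    (U.filter fun u => ∀ i, own i = own u → i ≠ u → i ∈ W).card ≤ n := by
  have key : ∀ u ∈ U.filter (fun u => ∀ i, own i = own u → i ≠ u → i ∈ W),
      dihIdx (x u) - (reflInd (x u) : ZMod n) * c ∈ H := fun u hu =>
    mem_class_of_others (hA (own u)).2.1 (by simp) fun i hi hne =>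
      hW i ((Finset.mem_filter.1 hu).2 i (Finset.mem_filter.1 hi).2 hne)
  refine card_class_le x U hU hr H hH c _ (Finset.filter_subset _ _) ?_ ?_
  · intro i hi h
    have := key i hi
    rw [(reflInd_eq_zero_or_one (x i)).resolve_right h] at this
    simpa using this
  · intro i hi h
    have := key i hi
    rw [h] at this
    simpa using this

theorem three_le_index [NeZero n] (hodd : Odd n) {H : AddSubgroup (ZMod n)} {q : ℕ} (hq : 2 ≤ q)
    (h : q * Nat.card H ≤ n) : 3 ≤ H.index ∧ q ≤ H.index := by
  have h1 : Nat.card H * H.index = n := by rw [H.card_mul_index, Nat.card_zmod]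
  have h2 : Odd H.index := Odd.of_dvd_nat hodd ⟨_, (mul_comm _ _).trans h1 |>.symm⟩
  have h3 : q ≤ H.index := by
    refine Nat.le_of_mul_le_mul_left ?_ (Nat.card_pos (α := H))
    rw [h1, mul_comm]
    exact h
  obtain ⟨k, hk⟩ := h2
  omega

theorem two_mul_add_two_mul_lt {f d : ℕ} (hf : 3 ≤ f) (hd : 3 ≤ d) :
    2 * f + 2 * d < f * d + 4 := by
  obtain ⟨a, rfl⟩ := Nat.exists_eq_add_of_le hf
  obtain ⟨b, rfl⟩ := Nat.exists_eq_add_of_le hd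
  nlinarith [Nat.zero_le (a * b)]

theorem two_mul_add_lt {f d : ℕ} (hf : 3 ≤ f) (hd : 3 ≤ d) : 2 * f + d < f * d + 1 := by
  obtain ⟨a, rfl⟩ := Nat.exists_eq_add_of_le hf
  obtain ⟨b, rfl⟩ := Nat.exists_eq_add_of_le hd
  nlinarith [Nat.zero_le (a * b)]

variable [Fintype κ]

theorem card_le_of_reflection_inside [NeZero n] (hodd : Odd n)
    (hA : ∀ k, IsAtomSeq ((Finset.univ.filter fun i => own i = k).val.map x))
    (hU : IsAtomSeq (U.val.map x)) (hC : IsProductOne (Uᶜ.val.map x))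
    (hmin : ∀ I : Finset κ, I.Nonempty → ∀ S ⊆ Uᶜ,
      S.val.map x = (Finset.univ.filter fun i => own i ∈ I).val.map x →
      ¬ IsProductOne ((Uᶜ \ S).val.map x))
    (hr : ∃ i ∈ Uᶜ, own i ∈ U.image own ∧ reflInd (x i) = 1) : Fintype.card κ ≤ 2 * n := by
  by_contra! hK
  obtain ⟨ε, H, c, W, o, e, s, D, hz, hWC, hW, hWc, -, hH, he, hs, hs1, hWsum, hf⟩ :=
    exists_structure_of_family hodd own x U hA hC hmin (U.image own)
      (fun i hi => Finset.mem_image_of_mem _ hi) hr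
  have hUcard := card_le_two_mul_of_isAtomSeq hU
  have hJU : (U.image own).card ≤ U.card := Finset.card_image_le
  have hcompl := Finset.card_compl_add_card (U.image own)
  have hHpos : 0 < Nat.card H := Nat.card_pos
  have hf1 : H.index * Nat.card H = n := by rw [H.index_mul_card, Nat.card_zmod]
  have hos : o + 1 + s ≤ n := (Nat.le_mul_of_pos_right _ hHpos).trans hH
  by_cases hUr : ∃ i ∈ U, reflInd (x i) = 1
  swap
  · push Not at hUr
    have := card_le_of_isAtomSeq_rotations hU hUr
    omega
  have hs2 : 1 ≤ s := hs1 (Finset.card_pos.1 (by omega))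
  obtain ⟨hf3, hf2⟩ := three_le_index hodd (q := o + 1 + s) (by omega) hH
  have hV := two_mul_card_image_le own U W
  have hQ : ((U.image own).filter fun k => ∃ i ∈ Uᶜ, own i = k ∧ i ∉ W).card ≤
      2 * (o + e) + D := by
    refine le_trans ?_ hWc
    refine (Finset.card_le_card fun k hk => ?_).trans (Finset.card_image_le (f := own))
    obtain ⟨hkJ, i, hi, rfl, hiW⟩ := Finset.mem_filter.1 hk
    exact Finset.mem_image_of_mem _ (Finset.mem_sdiff.2 ⟨Finset.mem_filter.2 ⟨hi, hkJ⟩, hiW⟩)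
  rcases card_eq_one_or_three_le hodd H with rfl | hd
  · rw [AddSubgroup.card_bot] at he
    simp only [AddSubgroup.mem_bot] at hW
    have hsib : ∀ u ∈ U.filter (fun u => ∀ i, own i = own u → i ≠ u → i ∈ W), ∃ w ∈ W,
        own w = own u ∧ (Finset.univ.filter fun i => own i = own u) = {u, w} ∧ w ≠ u ∧
        x u = .sr c ∧ x w = .sr c := fun u hu =>
      exists_sibling_of_class_bot hA hU hUr hW (Finset.mem_filter.1 hu).1
        (Finset.mem_filter.1 hu).2
    have hsame : ∀ i ∈ W, reflInd (x i) = 1 → x i = .sr c := fun i hi h =>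
      (eq_one_or_eq_sr (hW i hi)).resolve_left fun h1 => by simp [h1] at h
    set V := U.filter fun u => ∀ i, own i = own u → i ≠ u → i ∈ W
    have hVR : V.card ≤ (W.filter fun i => reflInd (x i) = 1).card := by
      choose! w hwW hwo hwp hwu hxu hxw using hsib
      refine Finset.card_le_card_of_injOn w (fun u hu => ?_) ?_
      · refine Finset.mem_filter.2 ⟨hwW u hu, ?_⟩
        rw [hxw u hu]
        rfl
      · intro u hu u' hu' huu
        have h1 : u' ∈ ({u, w u} : Finset ι) := by
          rw [← hwp u hu, Finset.mem_filter]
          exact ⟨Finset.mem_univ _, by rw [← hwo u hu, ← hwo u' hu', huu]⟩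
        rcases Finset.mem_insert.1 h1 with h | h
        · exact h.symm
        · rw [Finset.mem_singleton] at h
          exact absurd (huu.symm.trans h.symm) (hwu u' hu')
    have hVpos : 2 ≤ V.card := by omega
    obtain ⟨u, hu⟩ : V.Nonempty := Finset.card_pos.1 (by omega)
    obtain ⟨w, hwW, hwo, hpair, hwu, hxu, hxw⟩ := hsib u hu
    obtain ⟨p, hp, m, hm, hρp, hρm, hεp, hεm⟩ := exists_opposite_signs x ε hz.1 W hWsum
      ⟨w, hwW, by rw [hxw]; rfl⟩
    have hpm : p ≠ m := by
      rintro rfl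
      omega
    have hSW : ({p, m} : Finset ι) ⊆ W := by
      intro i hi
      rcases Finset.mem_insert.1 hi with rfl | hi
      · exact hp
      · rwa [Finset.mem_singleton.1 hi]
    have hWU : W ⊆ Uᶜ := hWC.trans (Finset.filter_subset _ _)
    have hSC := hSW.trans hWU
    refine hmin {own u} (Finset.singleton_nonempty _) {p, m} hSC ?_ ?_
    · simp only [Finset.mem_singleton]
      rw [hpair, Finset.insert_val_of_notMem (by simpa using hpm),
        Finset.insert_val_of_notMem (by simpa using hwu.symm)]
      simp [hxu, hxw, hsame p hp hρp, hsame m hm hρm]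
    · refine isProductOne_of_sign x ε hz.1 _ ?_ ?_ ?_
      · have h1 := Finset.sum_sdiff (f := fun i => ε i * reflInd (x i)) hSC
        have h2 := sum_pair_of_sign hεp hεm fun i => reflInd (x i)
        simp only [Int.cast_id] at h2
        rw [h2, hz.2.1, hρp, hρm] at h1
        simpa using h1
      · have h1 := Finset.sum_sdiff (f := fun i => (ε i : ZMod n) * dihIdx (x i)) hSC
        rw [sum_pair_of_sign hεp hεm, hz.2.2, hsame p hp hρp, hsame m hm hρm] at h1
        simpa using h1
      · rcases hf with hf | ⟨i, hi, hi1⟩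
        · have h4 : ({p, m} : Finset ι).card < (W.filter fun i => reflInd (x i) = 1).card := by
            rw [Finset.card_pair hpm]
            omega
          obtain ⟨i, hi, hi'⟩ := Finset.exists_mem_notMem_of_card_lt_card h4
          obtain ⟨hi1, hi2⟩ := Finset.mem_filter.1 hi
          exact ⟨i, Finset.mem_sdiff.2 ⟨hWU hi1, hi'⟩, hi2⟩
        · obtain ⟨h5, h6⟩ := Finset.mem_sdiff.1 hi
          exact ⟨i, Finset.mem_sdiff.2 ⟨h5, fun h => h6 (hSW h)⟩, hi1⟩
  · have hVn := card_filter_siblings_le hA hU hUr (H := H) (by omega) hW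
    have h5 : n + 4 ≤ 2 * H.index + 2 * Nat.card H := by omega
    have h6 := two_mul_add_two_mul_lt hf3 hd
    omega

theorem card_le_of_reflection_outside [NeZero n] (hn : 3 ≤ n) (hodd : Odd n)
    (hA : ∀ k, IsAtomSeq ((Finset.univ.filter fun i => own i = k).val.map x))
    (hU : IsAtomSeq (U.val.map x)) (hC : IsProductOne (Uᶜ.val.map x))
    (hmin : ∀ I : Finset κ, I.Nonempty → ∀ S ⊆ Uᶜ,
      S.val.map x = (Finset.univ.filter fun i => own i ∈ I).val.map x →
      ¬ IsProductOne ((Uᶜ \ S).val.map x))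
    (hrot : ∀ i ∈ Uᶜ, own i ∈ U.image own → reflInd (x i) ≠ 1)
    (hr : ∃ i ∈ Uᶜ, reflInd (x i) = 1) : Fintype.card κ ≤ 2 * n := by
  by_contra! hK
  obtain ⟨i₀, hi₀, hρ₀⟩ := hr
  have hi₀J : own i₀ ∉ U.image own := fun h => hrot i₀ hi₀ h hρ₀
  set J := insert (own i₀) (U.image own) with hJ
  obtain ⟨ε, H, c, W, o, e, s, D, hz, hWC, hW, -, hWr, hH, he, hs, hs1, hWsum, -⟩ :=
    exists_structure_of_family hodd own x U hA hC hmin J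
      (fun i hi => Finset.mem_insert_of_mem (Finset.mem_image_of_mem _ hi))
      ⟨i₀, hi₀, Finset.mem_insert_self _ _, hρ₀⟩
  have hJcard : J.card = (U.image own).card + 1 := Finset.card_insert_of_notMem hi₀J
  have hUcard := card_le_two_mul_of_isAtomSeq hU
  have hJU : (U.image own).card ≤ U.card := Finset.card_image_le
  have hcompl := Finset.card_compl_add_card J
  have hHpos : 0 < Nat.card H := Nat.card_pos
  have hf1 : H.index * Nat.card H = n := by rw [H.index_mul_card, Nat.card_zmod]
  have hos : o + 1 + s ≤ n := (Nat.le_mul_of_pos_right _ hHpos).trans hH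
  have hrot0 : ∀ i ∈ Uᶜ, own i ∈ U.image own → i ∉ W →
      i ∈ (Uᶜ.filter (fun i => own i ∈ J) \ W).filter fun i => reflInd (x i) = 0 := by
    intro i hi hiJ hiW
    refine Finset.mem_filter.2 ⟨Finset.mem_sdiff.2 ⟨Finset.mem_filter.2
      ⟨hi, Finset.mem_insert_of_mem hiJ⟩, hiW⟩, ?_⟩
    exact (reflInd_eq_zero_or_one _).resolve_right (hrot i hi hiJ)
  have hbot : H = ⊥ → 1 ≤ o := by
    rintro rfl
    rw [AddSubgroup.card_bot] at he
    by_contra! ho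
    obtain ⟨i, hi, hiJ, hi1⟩ := exists_ne_one_of_minimal hA hmin ⟨own i₀, Finset.mem_compl.2 hi₀J⟩
    have hiW : i ∈ W := by
      by_contra hiW
      have := Finset.card_pos.2 ⟨i, hrot0 i hi hiJ hiW⟩
      omega
    rcases eq_one_or_eq_sr (by simpa using hW i hiW) with h | h
    · exact hi1 h
    · exact hrot i hi hiJ (by rw [h]; rfl)
  by_cases hUr : ∃ i ∈ U, reflInd (x i) = 1
  swap
  · push Not at hUr
    have hUn := card_le_of_isAtomSeq_rotations hU hUr
    rcases card_eq_one_or_three_le hodd H with hb | hd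
    · have := hbot hb
      omega
    · have : (o + 1 + s) * 3 ≤ n := (Nat.mul_le_mul_left _ hd).trans hH
      omega
  have hJlt : (U.image own).card < U.card := by
    refine lt_of_le_of_ne hJU fun heq => ?_
    have hinj := Finset.card_image_iff.1 heq
    obtain ⟨u, hu, hρu⟩ := hUr
    obtain ⟨w, hw, hwu, hρw⟩ := exists_ne_reflection x (hA (own u)).2.1
      (show u ∈ Finset.univ.filter fun i => own i = own u by simp) hρu
    have hwo := (Finset.mem_filter.1 hw).2
    have hwU : w ∈ U := by
      by_contra hwU
      refine hrot w (Finset.mem_compl.2 hwU) ?_ hρw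
      rw [hwo]
      exact Finset.mem_image_of_mem _ hu
    exact hwu (hinj hwU hu hwo)
  have hs2 : 1 ≤ s := hs1 (Finset.card_pos.1 (by omega))
  obtain ⟨hf3, hf2⟩ := three_le_index hodd (q := o + 1 + s) (by omega) hH
  have hV := two_mul_card_image_le own U W
  have hQ : ((U.image own).filter fun k => ∃ i ∈ Uᶜ, own i = k ∧ i ∉ W).card ≤ o + e := by
    refine le_trans ?_ hWr
    refine (Finset.card_le_card fun k hk => ?_).trans (Finset.card_image_le (f := own))
    obtain ⟨hkJ, i, hi, rfl, hiW⟩ := Finset.mem_filter.1 hk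
    exact Finset.mem_image_of_mem _ (hrot0 i hi hkJ hiW)
  rcases card_eq_one_or_three_le hodd H with rfl | hd
  · have ho := hbot rfl
    rw [AddSubgroup.card_bot] at he
    simp only [AddSubgroup.mem_bot] at hW
    have hVe : (U.filter fun u => ∀ i, own i = own u → i ≠ u → i ∈ W).card = 0 := by
      rw [Finset.card_eq_zero, Finset.eq_empty_iff_forall_notMem]
      intro u hu
      obtain ⟨huU, huW⟩ := Finset.mem_filter.1 hu
      obtain ⟨w, hwW, hwo, -, -, -, hxw⟩ := exists_sibling_of_class_bot hA hU hUr hW huU huW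
      refine hrot w (Finset.mem_filter.1 (hWC hwW)).1 ?_ (by rw [hxw]; rfl)
      rw [hwo]
      exact Finset.mem_image_of_mem _ huU
    omega
  · have hVn := card_filter_siblings_le hA hU hUr (H := H) (by omega) hW
    have h5 : n + 1 ≤ 2 * H.index + Nat.card H := by omega
    have h6 := two_mul_add_lt hf3 hd
    omega

theorem card_le_of_minimal_family [NeZero n] (hn : 3 ≤ n) (hodd : Odd n)
    (hA : ∀ k, IsAtomSeq ((Finset.univ.filter fun i => own i = k).val.map x))
    (hU : IsAtomSeq (U.val.map x)) (hC : IsProductOne (Uᶜ.val.map x))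
    (hmin : ∀ I : Finset κ, I.Nonempty → ∀ S ⊆ Uᶜ,
      S.val.map x = (Finset.univ.filter fun i => own i ∈ I).val.map x →
      ¬ IsProductOne ((Uᶜ \ S).val.map x)) : Fintype.card κ ≤ 2 * n := by
  by_cases hr : ∃ i ∈ Uᶜ, reflInd (x i) = 1
  · by_cases hr' : ∃ i ∈ Uᶜ, own i ∈ U.image own ∧ reflInd (x i) = 1
    · exact card_le_of_reflection_inside hodd hA hU hC hmin hr'
    · push Not at hr'
      exact card_le_of_reflection_outside hn hodd hA hU hC hmin hr' hr
  · push Not at hr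
    have h1 := compl_image_eq_empty_of_rotations hA hC hmin hr
    have h2 := Finset.card_compl_add_card (U.image own)
    have h3 : (U.image own).card ≤ U.card := Finset.card_image_le
    have h4 := card_le_two_mul_of_isAtomSeq hU
    rw [h1, Finset.card_empty] at h2
    omega

end Main

/-! ### From atoms to product-one sequences -/

section Transfer

theorem isProductOne_zero {G : Type*} [Group G] : IsProductOne (0 : Multiset G) := ⟨[], rfl, rfl⟩

theorem IsProductOne.add {G : Type*} [Group G] {A B : Multiset G} (hA : IsProductOne A)
    (hB : IsProductOne B) : IsProductOne (A + B) := by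
  obtain ⟨a, rfl, ha⟩ := hA
  obtain ⟨b, rfl, hb⟩ := hB
  exact ⟨a ++ b, by simp, by simp [ha, hb]⟩

theorem isProductOne_sum {G : Type*} [Group G] (f : Multiset (Multiset G))
    (h : ∀ B ∈ f, IsProductOne B) : IsProductOne f.sum :=
  Multiset.sum_induction IsProductOne f (fun _ _ => IsProductOne.add) isProductOne_zero h

theorem BDvd.trans {G : Type*} [Group G] {A B C : Multiset G} (h₁ : BDvd A B) (h₂ : BDvd B C) :
    BDvd A C := by
  obtain ⟨D, hD, rfl⟩ := h₁
  obtain ⟨E, hE, rfl⟩ := h₂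
  exact ⟨D + E, hD.add hE, add_assoc _ _ _⟩

theorem IsProductOne.exists_factorization {G : Type*} [Group G] {S : Multiset G}
    (hS : IsProductOne S) : ∃ z, IsFactorization S z := by
  induction hc : Multiset.card S using Nat.strong_induction_on generalizing S with
  | _ m ih =>
    by_cases h0 : S = 0
    · exact ⟨0, by simp, by simp [h0]⟩
    by_cases hat : IsAtomSeq S
    · exact ⟨{S}, by simpa using hat, by simp⟩
    have : ∃ A B : Multiset G, S = A + B ∧ IsProductOne A ∧ IsProductOne B ∧ A ≠ 0 ∧ B ≠ 0 := by
      by_contra! h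
      exact hat ⟨h0, hS, fun A B hAB hA hB => or_iff_not_imp_left.2 (h A B hAB hA hB)⟩
    obtain ⟨A, B, rfl, hA, hB, hA0, hB0⟩ := this
    rw [Multiset.card_add] at hc
    have hA1 := Multiset.card_pos.2 hA0
    have hB1 := Multiset.card_pos.2 hB0
    obtain ⟨y, hy, hyA⟩ := ih _ (by omega) hA rfl
    obtain ⟨z, hz, hzB⟩ := ih _ (by omega) hB rfl
    refine ⟨y + z, fun V hV => ?_, by rw [Multiset.sum_add, hyA, hzB]⟩
    exact (Multiset.mem_add.1 hV).elim (hy V) (hz V)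

theorem exists_le_bDvd_of_le_bind {G : Type*} [Group G] (z : Multiset G → Multiset (Multiset G))
    (f : Multiset (Multiset G)) (hz : ∀ B ∈ f, IsFactorization B (z B))
    (t : Multiset (Multiset G)) (ht : t ≤ f.bind z) :
    ∃ s ≤ f, Multiset.card s ≤ Multiset.card t ∧ BDvd t.sum s.sum := by
  classical
  induction f using Multiset.induction_on generalizing t with
  | empty =>
    rw [Multiset.zero_bind, Multiset.le_zero] at ht
    exact ⟨0, le_rfl, by simp, 0, isProductOne_zero, by simp [ht]⟩
  | cons B f ih =>
    rw [Multiset.cons_bind] at ht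
    obtain ⟨s, hs, hcard, hdvd⟩ := ih (fun C hC => hz C (Multiset.mem_cons_of_mem hC)) (t - z B)
      (tsub_le_iff_left.2 ht)
    have hsplit : t - z B + t ∩ z B = t := Multiset.sub_add_inter t (z B)
    by_cases h0 : t ∩ z B = 0
    · rw [h0, add_zero] at hsplit
      rw [hsplit] at hcard hdvd
      exact ⟨s, hs.trans (Multiset.le_cons_self _ _), hcard, hdvd⟩
    · refine ⟨B ::ₘ s, Multiset.cons_le_cons B hs, ?_, ?_⟩
      · have h1 := congrArg Multiset.card hsplit
        have h2 := Multiset.card_pos.2 h0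
        rw [Multiset.card_add] at h1
        rw [Multiset.card_cons]
        omega
      · obtain ⟨C, hC, hsC⟩ := hdvd
        obtain ⟨hat, hsum⟩ := hz B (Multiset.mem_cons_self _ _)
        refine ⟨C + (z B - t ∩ z B).sum, hC.add (isProductOne_sum _ fun V hV =>
          (hat V (Multiset.mem_of_le (Multiset.sub_le_self _ _) hV)).2.1), ?_⟩
        have h1 := congrArg Multiset.sum (tsub_add_cancel_of_le
          (Multiset.inter_le_right (s := t) (t := z B)))
        have h2 := congrArg Multiset.sum hsplit
        rw [Multiset.sum_add] at h1 h2
        rw [hsum] at h1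
        rw [Multiset.sum_cons, hsC, ← h2]
        nth_rewrite 1 [← h1]
        abel

theorem map_val_eq_sum_singleton {ι α : Type*} (x : ι → α) (s : Finset ι) :
    s.val.map x = ∑ i ∈ s, ({x i} : Multiset α) := by
  rw [Finset.sum, ← Multiset.sum_map_singleton (s.val.map x), Multiset.map_map]
  rfl

/-- The terms of the sequences in the list `l`, indexed by the position of the sequence in `l`
and the position of the term in the sequence. -/
noncomputable def familyTerm {α : Type*} (l : List (Multiset α))
    (i : Σ k : Fin l.length, Fin (l.get k).toList.length) : α :=
  (l.get i.1).toList.get i.2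

theorem map_familyTerm {α : Type*} (l : List (Multiset α)) (I : Finset (Fin l.length)) :
    (Finset.univ.filter fun i : Σ k : Fin l.length, Fin (l.get k).toList.length =>
      i.1 ∈ I).val.map (familyTerm l) = ∑ k ∈ I, l.get k := by
  have h : (Finset.univ.filter fun i : Σ k : Fin l.length, Fin (l.get k).toList.length =>
      i.1 ∈ I) = I.sigma fun _ => Finset.univ := by
    ext i
    simp
  rw [h, map_val_eq_sum_singleton, Finset.sum_sigma]
  refine Finset.sum_congr rfl fun k _ => ?_
  rw [← map_val_eq_sum_singleton (fun j => familyTerm l ⟨k, j⟩)]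
  change (((List.finRange _).map (l.get k).toList.get : List α) : Multiset α) = _
  rw [List.map_get_finRange, Multiset.coe_toList]

theorem exists_lt_bDvd {n : ℕ} (hn : 3 ≤ n) (hodd : Odd n) {U : Multiset (DihedralGroup n)}
    (hU : IsAtomSeq U) {f : Multiset (Multiset (DihedralGroup n))} (hf : ∀ V ∈ f, IsAtomSeq V)
    (hdvd : BDvd U f.sum) (hcard : 2 * n < Multiset.card f) : ∃ t < f, BDvd U t.sum := by
  classical
  have : NeZero n := ⟨by omega⟩
  induction f using Quotient.inductionOn with
  | _ l =>
  have hl : (l : Multiset (Multiset (DihedralGroup n))) =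
      (Finset.univ : Finset (Fin l.length)).val.map l.get := by
    change _ = (((List.finRange _).map l.get : List (Multiset (DihedralGroup n))) :
      Multiset (Multiset (DihedralGroup n)))
    rw [List.map_get_finRange]
  obtain ⟨C, hC, hUC⟩ := hdvd
  have htot : (Finset.univ : Finset (Σ k : Fin l.length, Fin (l.get k).toList.length)).val.map
      (familyTerm l) = U + C := by
    rw [← hUC]
    have := map_familyTerm l Finset.univ
    simp only [Finset.mem_univ, Finset.filter_true] at this
    rw [this, Finset.sum, ← hl]
    rfl
  obtain ⟨T, -, hTU, hTC⟩ := exists_finset_of_map_eq_add _ _ _ _ htot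
  rw [← Finset.compl_eq_univ_sdiff] at hTC
  by_contra! hno
  refine absurd (card_le_of_minimal_family (own := Sigma.fst) (x := familyTerm l) (U := T) hn hodd
    ?_ (by rwa [hTU]) (by rwa [hTC]) ?_) (by simpa using hcard)
  · intro k
    have := map_familyTerm l {k}
    simp only [Finset.mem_singleton, Finset.sum_singleton] at this
    rw [this]
    exact hf _ (List.get_mem l k)
  · intro I hI S hS hSI hone
    rw [map_familyTerm] at hSI
    refine hno (Iᶜ.val.map l.get) ?_ ⟨_, hone, ?_⟩
    · change _ < (l : Multiset (Multiset (DihedralGroup n)))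
      rw [hl]
      refine Multiset.map_lt_map (Finset.val_lt_iff.2 ?_)
      rw [Finset.ssubset_univ_iff, Ne, Finset.compl_eq_univ_iff]
      exact hI.ne_empty
    · have h1 := Finset.sum_add_sum_compl I l.get
      have h2 : ∑ k, l.get k = U + C := by
        rw [← hUC, Finset.sum, ← hl]
        rfl
      have h3 : (Tᶜ \ S).val.map (familyTerm l) + S.val.map (familyTerm l) = C := by
        rw [← hTC]
        simp only [map_val_eq_sum_singleton]
        exact Finset.sum_sdiff hS
      rw [hSI] at h3
      change ∑ k ∈ Iᶜ, l.get k = _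
      rw [h2, ← h3, ← add_assoc, add_comm] at h1
      exact add_right_cancel h1

theorem exists_le_card_le_bDvd {n : ℕ} (hn : 3 ≤ n) (hodd : Odd n)
    {U : Multiset (DihedralGroup n)} (hU : IsAtomSeq U)
    {f : Multiset (Multiset (DihedralGroup n))} (hf : ∀ V ∈ f, IsAtomSeq V)
    (hdvd : BDvd U f.sum) : ∃ t ≤ f, Multiset.card t ≤ 2 * n ∧ BDvd U t.sum := by
  induction hc : Multiset.card f using Nat.strong_induction_on generalizing f with
  | _ m ih =>
    rcases le_or_gt (Multiset.card f) (2 * n) with h | h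
    · exact ⟨f, le_rfl, h, hdvd⟩
    obtain ⟨t, ht, htU⟩ := exists_lt_bDvd hn hodd hU hf hdvd h
    obtain ⟨s, hs, hsc, hsU⟩ := ih _ (hc ▸ Multiset.card_lt_card ht)
      (fun V hV => hf V (Multiset.mem_of_le ht.le hV)) htU rfl
    exact ⟨s, hs.trans ht.le, hsc, hsU⟩

theorem omegaAt_le {n : ℕ} (hn : 3 ≤ n) (hodd : Odd n) {U : Multiset (DihedralGroup n)}
    (hU : IsAtomSeq U) : omegaAt U ≤ ((2 * n : ℕ) : ℕ∞) := by
  refine sInf_le fun f hf hdvd => ?_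
  have hfac : ∀ B : Multiset (DihedralGroup n), ∃ z, IsProductOne B → IsFactorization B z := by
    intro B
    by_cases hB : IsProductOne B
    · exact hB.exists_factorization.imp fun _ hz _ => hz
    · exact ⟨0, fun h => absurd h hB⟩
  choose z hz using hfac
  have hsum : (f.bind z).sum = f.sum := by
    rw [Multiset.sum_bind, Multiset.map_congr rfl fun B hB => (hz B (hf B hB)).2, Multiset.map_id']
  obtain ⟨t, ht, htc, htU⟩ := exists_le_card_le_bDvd hn hodd hU (f := f.bind z) (fun V hV => by
    obtain ⟨B, hB, hVB⟩ := Multiset.mem_bind.1 hV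
    exact (hz B (hf B hB)).1 V hVB) (hsum ▸ hdvd)
  obtain ⟨s, hs, hsc, hst⟩ := exists_le_bDvd_of_le_bind z f (fun B hB => hz B (hf B hB)) t ht
  exact ⟨s, hs, by exact_mod_cast hsc.trans htc, htU.trans hst⟩

end Transfer

end ProductOne

open ProductOne in
/-- Let `G` be a dihedral group of order `2n`, where `n ≥ 3` is odd.
Then `ω(G) = D(G) = 2n`. -/
theorem omega_eq_davenport_eq_two_n (n : ℕ) (hn : 3 ≤ n) (hodd : Odd n) :
    omegaInv (DihedralGroup n) = ((2 * n : ℕ) : ℕ∞) ∧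
    Davenport (DihedralGroup n) = 2 * n := by
  exact ⟨le_antisymm (iSup₂_le fun _ hU => omegaAt_le hn hodd hU)
    (two_mul_le_omegaInv hn hodd), davenport_dihedral hn hodd⟩
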